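/- Let n ≥ 2. There exists a finite generating set Σ of T_n with n+1 elements such that for every ω ∈ T_n, N(ω)/3 ≤ |ω|_Σ ≤ 15(n−1)·N(ω) + 3n, where N(ω) denotes the caret number of ω. -/

import Mathlib

noncomputable section

namespace ThompsonPaper

/-- The circle `ℝ/ℤ`. -/
abbrev Circle : Type := AddCircle (1 : ℝ)

/-- Homeomorphisms of a topological space form a group under composition,
with `(f * g) x = f (g x)`. -/
instance homeoGroup {α : Type*} [TopologicalSpace α] : Group (α ≃ₜ α) where
  mul f g := g.trans f
  one := Homeomorph.refl α
  inv := Homeomorph.symm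
  mul_assoc _ _ _ := Homeomorph.ext fun _ => rfl
  one_mul _ := Homeomorph.ext fun _ => rfl
  mul_one _ := Homeomorph.ext fun _ => rfl
  inv_mul_cancel f := Homeomorph.ext fun x => f.symm_apply_apply x

/-- `x` is an `n`-adic rational: `x = a / n ^ k` with `a` an integer, `k` a natural number. -/
def IsNAdic (n : ℕ) (x : ℝ) : Prop := ∃ a : ℤ, ∃ k : ℕ, x = (a : ℝ) / (n : ℝ) ^ k

/-- The set of `n`-adic points of the circle. -/
def nAdicPoints (n : ℕ) : Set Circle := { p | ∃ x : ℝ, IsNAdic n x ∧ p = (x : Circle) }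

/-- `F : ℝ → ℝ` is a lift of the circle map `f`. -/
def IsLift (f : Circle ≃ₜ Circle) (F : ℝ → ℝ) : Prop :=
  ∀ x : ℝ, f (x : Circle) = ((F x : ℝ) : Circle)

/-- `F : ℝ → ℝ` commutes with translation by `1` and is piecewise affine with finitely
many breakpoints (modulo `1`), all breakpoints at `n`-adic rationals, and with the slope
of every affine piece an integer power of `n`. -/
def PiecewiseNAffine (n : ℕ) (F : ℝ → ℝ) : Prop :=
  (∀ x : ℝ, F (x + 1) = F x + 1) ∧
  ∃ m : ℕ, ∃ t : ℕ → ℝ, ∃ slope : ℕ → ℤ, ∃ c : ℕ → ℝ,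
    0 < m ∧ t 0 = 0 ∧ t m = 1 ∧
    (∀ i, i < m → t i < t (i + 1)) ∧
    (∀ i, i ≤ m → IsNAdic n (t i)) ∧
    (∀ i, i < m → ∀ x ∈ Set.Icc (t i) (t (i + 1)),
      F x = (n : ℝ) ^ (slope i) * x + c i)

/-- Membership in Thompson's group `T_n`: an orientation-preserving homeomorphism of the
circle `ℝ/ℤ` mapping the set of `n`-adic points onto itself, which is piecewise affine
with finitely many breakpoints, all breakpoints at `n`-adic points, and all slopes integer
powers of `n`.  (Orientation preservation and the piecewise affine structure are expressed
through a strictly increasing lift.) -/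
def InT (n : ℕ) (f : Circle ≃ₜ Circle) : Prop :=
  f '' nAdicPoints n = nAdicPoints n ∧
  ∃ F : ℝ → ℝ, StrictMono F ∧ IsLift f F ∧ PiecewiseNAffine n F

/-- Thompson's group `T_n`, as a set of circle homeomorphisms. -/
def TnSet (n : ℕ) : Set (Circle ≃ₜ Circle) := { f | InT n f }

/-- Thompson's group `T_n`, as a subgroup of the homeomorphism group of the circle.
(The set `TnSet n` is closed under the group operations, so this subgroup has exactly
`TnSet n` as its underlying set.) -/
def Tn (n : ℕ) : Subgroup (Circle ≃ₜ Circle) := Subgroup.closure (TnSet n)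

/-- `IsStdSubdiv n k P` : `P` is the (finite) set of left endpoints of the intervals of a
standard `n`-adic subdivision of the circle `ℝ/ℤ` obtained from the trivial partition
`{[0,1)}` by `k` subdivision steps, each step replacing one interval by the `n` equal
subintervals it comprises. -/
inductive IsStdSubdiv (n : ℕ) : ℕ → Finset ℝ → Prop
  | base : IsStdSubdiv n 0 {0}
  | step (k : ℕ) (P : Finset ℝ) (a b : ℝ) (hP : IsStdSubdiv n k P) (ha : a ∈ P)
      (hb : b ∈ insert (1 : ℝ) P) (hab : a < b)
      (hmin : ∀ c ∈ insert (1 : ℝ) P, a < c → b ≤ c) :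
      IsStdSubdiv n (k + 1) (P ∪ (Finset.range n).image (fun j : ℕ => a + j * (b - a) / n))

/-- `b` is the right endpoint of the interval with left endpoint `a` of the subdivision
with set of left endpoints `P` (i.e. the successor of `a` in `P ∪ {1}`). -/
def IsNext (P : Finset ℝ) (a b : ℝ) : Prop :=
  b ∈ insert (1 : ℝ) P ∧ a < b ∧ ∀ c ∈ insert (1 : ℝ) P, a < c → b ≤ c

/-- `f` is affine on each interval of the subdivision of the circle whose set of left
endpoints is `P`. -/
def AffineOnParts (P : Finset ℝ) (f : Circle ≃ₜ Circle) : Prop :=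
  ∀ a ∈ P, ∀ b : ℝ, IsNext P a b →
    ∃ s c : ℝ, ∀ x ∈ Set.Icc a b, f (x : Circle) = ((s * x + c : ℝ) : Circle)

/-- The set of endpoints of the subdivision of the circle whose set of left endpoints is
`P`, viewed inside the circle. -/
def circlePts (P : Finset ℝ) : Set Circle := (fun x : ℝ => (x : Circle)) '' ↑P

/-- The caret number of `f ∈ T_n`: the least `k` such that there is a standard `n`-adic
subdivision `P` of the circle obtained by `k` subdivision steps with `f` affine on each
interval of `P` and with the image partition `f(P)` again a standard `n`-adic
subdivision. -/
def caretNumber (n : ℕ) (f : Circle ≃ₜ Circle) : ℕ :=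
  sInf { k : ℕ | ∃ P : Finset ℝ, IsStdSubdiv n k P ∧ AffineOnParts P f ∧
    ∃ Q : Finset ℝ, IsStdSubdiv n k Q ∧ f '' circlePts P = circlePts Q }

/-- The word length of `g` with respect to a set `S` of generators: the least `k` such
that `g` is a product of `k` elements of `S ∪ S⁻¹`. -/
def wordLength {G : Type*} [Group G] (S : Set G) (g : G) : ℕ :=
  sInf { k : ℕ | ∃ w : List G, w.length = k ∧ (∀ x ∈ w, x ∈ S ∨ x⁻¹ ∈ S) ∧ w.prod = g }

/-! ### Subdivisions -/

def Parts (P : Finset ℝ) (a b : ℝ) : Prop := a ∈ P ∧ IsNext P a b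

def kd (n : ℕ) (a b : ℝ) (j : ℕ) : ℝ := a + j * (b - a) / n

def sp (n : ℕ) (P : Finset ℝ) (a b : ℝ) : Finset ℝ :=
  P ∪ (Finset.range n).image (fun j : ℕ => a + j * (b - a) / n)

def Wf (P : Finset ℝ) : Prop := (0 : ℝ) ∈ P ∧ ∀ x ∈ P, 0 ≤ x ∧ x < 1

def Step (n : ℕ) (P P' : Finset ℝ) : Prop := ∃ a b, Parts P a b ∧ P' = sp n P a b

inductive Steps (n : ℕ) : ℕ → Finset ℝ → Finset ℝ → Prop
  | refl (P : Finset ℝ) : Steps n 0 P P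
  | head (k : ℕ) (P P' P'' : Finset ℝ) : Step n P P' → Steps n k P' P'' → Steps n (k + 1) P P''

lemma Steps.trans {n : ℕ} {k l : ℕ} {P Q R : Finset ℝ} (h : Steps n k P Q) (h' : Steps n l Q R) :
    Steps n (k + l) P R := by
  induction h with
  | refl P => simpa using h'
  | head k P P' P'' hs _ ih =>
    have := Steps.head _ _ _ _ hs (ih h')
    rwa [show k + 1 + l = k + l + 1 by ring]

lemma Steps.single {n : ℕ} {P Q : Finset ℝ} (h : Step n P Q) : Steps n 1 P Q :=
  Steps.head 0 _ _ _ h (Steps.refl _)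

lemma std_of_steps {n k l : ℕ} {P Q : Finset ℝ} (h : Steps n k P Q) (hP : IsStdSubdiv n l P) :
    IsStdSubdiv n (l + k) Q := by
  induction h generalizing l with
  | refl P => simpa using hP
  | head k P P' P'' hs _ ih =>
    obtain ⟨a, b, ⟨ha, hb, hab, hm⟩, rfl⟩ := hs
    have := ih (IsStdSubdiv.step l P a b hP ha hb hab hm)
    rwa [show l + (k + 1) = l + 1 + k by ring]

lemma steps_of_std {n k : ℕ} {P : Finset ℝ} (h : IsStdSubdiv n k P) : Steps n k {0} P := by
  induction h with
  | base => exact Steps.refl _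
  | step k P a b hP ha hb hab hm ih =>
    exact ih.trans (Steps.single ⟨a, b, ⟨ha, hb, hab, hm⟩, rfl⟩)

lemma Parts.lt {P : Finset ℝ} {a b : ℝ} (h : Parts P a b) : a < b := h.2.2.1

lemma Parts.uniq {P : Finset ℝ} {a b b' : ℝ} (h : Parts P a b) (h' : Parts P a b') : b = b' :=
  le_antisymm (h.2.2.2 _ h'.2.1 h'.2.2.1) (h'.2.2.2 _ h.2.1 h.2.2.1)

lemma Parts.le_one {P : Finset ℝ} (hP : Wf P) {a b : ℝ} (h : Parts P a b) : b ≤ 1 := by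
  rcases Finset.mem_insert.1 h.2.1 with h | h
  · exact h.le
  · exact (hP.2 _ h).2.le

lemma Parts.nonneg {P : Finset ℝ} (hP : Wf P) {a b : ℝ} (h : Parts P a b) : 0 ≤ a :=
  (hP.2 _ h.1).1

lemma kd_zero {n : ℕ} {a b : ℝ} : kd n a b 0 = a := by simp [kd]

lemma kd_n {n : ℕ} (hn : 2 ≤ n) {a b : ℝ} : kd n a b n = b := by
  have : (n : ℝ) ≠ 0 := by positivity
  unfold kd; field_simp; ring

lemma kd_lt {n : ℕ} (hn : 2 ≤ n) {a b : ℝ} (hab : a < b) {i j : ℕ} :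
    kd n a b i < kd n a b j ↔ i < j := by
  have h0 : (0 : ℝ) < n := by positivity
  have h1 : 0 < (b - a) / n := div_pos (by linarith) h0
  unfold kd
  rw [mul_div_assoc, mul_div_assoc, add_lt_add_iff_left, mul_lt_mul_iff_left₀ h1, Nat.cast_lt]

lemma kd_le {n : ℕ} (hn : 2 ≤ n) {a b : ℝ} (hab : a < b) {i j : ℕ} :
    kd n a b i ≤ kd n a b j ↔ i ≤ j := by
  rw [← not_lt, kd_lt hn hab, not_lt]

lemma mem_sp {n : ℕ} {P : Finset ℝ} {a b x : ℝ} :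
    x ∈ sp n P a b ↔ x ∈ P ∨ ∃ j < n, x = kd n a b j := by
  simp only [sp, Finset.mem_union, Finset.mem_image, Finset.mem_range, kd]
  constructor
  · rintro (h | ⟨j, hj, rfl⟩)
    · exact Or.inl h
    · exact Or.inr ⟨j, hj, rfl⟩
  · rintro (h | ⟨j, hj, rfl⟩)
    · exact Or.inl h
    · exact Or.inr ⟨j, hj, rfl⟩

lemma exists_part {P : Finset ℝ} (hP : Wf P) {x : ℝ} (h0 : 0 ≤ x) (h1 : x < 1) :
    ∃ a b, Parts P a b ∧ a ≤ x ∧ x < b := by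
  classical
  have hne : (P.filter (· ≤ x)).Nonempty := ⟨0, by simp [hP.1, h0]⟩
  have hne' : ((insert (1:ℝ) P).filter (x < ·)).Nonempty := ⟨1, by simp [h1]⟩
  have ha := Finset.max'_mem _ hne
  have hb := Finset.min'_mem _ hne'
  have ha' := Finset.mem_filter.1 ha
  have hb' := Finset.mem_filter.1 hb
  refine ⟨_, _, ⟨ha'.1, hb'.1, lt_of_le_of_lt ha'.2 hb'.2, ?_⟩, ha'.2, hb'.2⟩
  intro c hc hac
  apply Finset.min'_le
  rw [Finset.mem_filter]
  refine ⟨hc, ?_⟩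
  by_contra hcx
  push Not at hcx
  have hcP : c ∈ P := by
    rcases Finset.mem_insert.1 hc with h | h
    · linarith
    · exact h
  have := Finset.le_max' (P.filter (· ≤ x)) c (by simp [hcP, hcx])
  linarith

lemma exists_next {P : Finset ℝ} (hP : Wf P) {a : ℝ} (ha : a ∈ P) : ∃ b, Parts P a b := by
  obtain ⟨a', b, h, h1, h2⟩ := exists_part hP (hP.2 a ha).1 (hP.2 a ha).2
  have : a = a' := by
    by_contra hne
    have := h.2.2.2 a (Finset.mem_insert_of_mem ha) (lt_of_le_of_ne h1 (Ne.symm hne))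
    linarith
  exact ⟨b, this ▸ h⟩

/-- disjointness of parts -/
lemma Parts.disj {P : Finset ℝ} {a b c d : ℝ} (h : Parts P a b) (h' : Parts P c d) (hne : c ≠ a) :
    d ≤ a ∨ b ≤ c := by
  rcases lt_or_gt_of_ne hne with h1 | h1
  · exact Or.inl (h'.2.2.2 a (Finset.mem_insert_of_mem h.1) h1)
  · exact Or.inr (h.2.2.2 c (Finset.mem_insert_of_mem h'.1) h1)

lemma Parts.eq_of_overlap {P : Finset ℝ} {a b c d x : ℝ} (h : Parts P a b) (h' : Parts P c d)
    (h1 : a ≤ x) (h2 : x < b) (h3 : c ≤ x) (h4 : x < d) : c = a ∧ d = b := by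
  have : c = a := by
    by_contra hne
    rcases h.disj h' hne with h | h <;> linarith
  subst this
  exact ⟨rfl, h'.uniq h⟩

lemma parts_sp_old {n : ℕ} (hn : 2 ≤ n) {P : Finset ℝ} {a b c d : ℝ} (h : Parts P a b)
    (h' : Parts P c d) (hne : c ≠ a) : Parts (sp n P a b) c d := by
  have hd := h.disj h' hne
  refine ⟨mem_sp.2 (Or.inl h'.1), ?_, h'.lt, ?_⟩
  · rcases Finset.mem_insert.1 h'.2.1 with h | h
    · simp [h]
    · exact Finset.mem_insert_of_mem (mem_sp.2 (Or.inl h))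
  · intro y hy hcy
    rcases Finset.mem_insert.1 hy with rfl | hy
    · exact h'.2.2.2 _ (by simp) hcy
    · rcases mem_sp.1 hy with hy | ⟨j, hj, rfl⟩
      · exact h'.2.2.2 _ (Finset.mem_insert_of_mem hy) hcy
      · have h1 : a ≤ kd n a b j := by
          have := (kd_le hn h.lt (i := 0) (j := j)).2 (Nat.zero_le _)
          rwa [kd_zero] at this
        have h2 : kd n a b j < b := by
          have := (kd_lt hn h.lt (i := j) (j := n)).2 hj
          rwa [kd_n hn] at this
        rcases hd with hd | hd <;> linarith

lemma parts_sp_new {n : ℕ} (hn : 2 ≤ n) {P : Finset ℝ} {a b : ℝ} (h : Parts P a b)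
    {j : ℕ} (hj : j < n) : Parts (sp n P a b) (kd n a b j) (kd n a b (j + 1)) := by
  refine ⟨mem_sp.2 (Or.inr ⟨j, hj, rfl⟩), ?_, (kd_lt hn h.lt).2 (Nat.lt_succ_self j), ?_⟩
  · rcases Nat.lt_or_ge (j + 1) n with h1 | h1
    · exact Finset.mem_insert_of_mem (mem_sp.2 (Or.inr ⟨j + 1, h1, rfl⟩))
    · have : j + 1 = n := by omega
      rw [this, kd_n hn]
      rcases Finset.mem_insert.1 h.2.1 with h | h
      · simp [h]
      · exact Finset.mem_insert_of_mem (mem_sp.2 (Or.inl h))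
  · intro c hc hlt
    have key : c ∈ insert (1:ℝ) P → kd n a b (j + 1) ≤ c := by
      intro hc
      have h1 : a ≤ kd n a b j := by
        have := (kd_le hn h.lt (i := 0) (j := j)).2 (Nat.zero_le _)
        rwa [kd_zero] at this
      have h2 : b ≤ c := h.2.2.2 c hc (by linarith)
      have h3 : kd n a b (j + 1) ≤ b := by
        have := (kd_le hn h.lt (i := j + 1) (j := n)).2 hj
        rwa [kd_n hn] at this
      linarith
    rcases Finset.mem_insert.1 hc with hc | hc
    · exact key (by simp [hc])
    · rcases mem_sp.1 hc with hc | ⟨l, hl, rfl⟩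
      · exact key (Finset.mem_insert_of_mem hc)
      · rw [kd_lt hn h.lt] at hlt
        exact (kd_le hn h.lt).2 hlt

lemma wf_sp {n : ℕ} (hn : 2 ≤ n) {P : Finset ℝ} (hP : Wf P) {a b : ℝ} (h : Parts P a b) :
    Wf (sp n P a b) := by
  refine ⟨mem_sp.2 (Or.inl hP.1), fun x hx => ?_⟩
  rcases mem_sp.1 hx with hx | ⟨j, hj, rfl⟩
  · exact hP.2 x hx
  · have h1 : a ≤ kd n a b j := by
      have := (kd_le hn h.lt (i := 0) (j := j)).2 (Nat.zero_le _)
      rwa [kd_zero] at this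
    have h2 : kd n a b j < b := by
      have := (kd_lt hn h.lt (i := j) (j := n)).2 hj
      rwa [kd_n hn] at this
    exact ⟨(h.nonneg hP).trans h1, h2.trans_le (h.le_one hP)⟩

lemma parts_sp {n : ℕ} (hn : 2 ≤ n) {P : Finset ℝ} (hP : Wf P) {a b c d : ℝ} (h : Parts P a b) :
    Parts (sp n P a b) c d ↔ (Parts P c d ∧ c ≠ a) ∨
      ∃ j < n, c = kd n a b j ∧ d = kd n a b (j + 1) := by
  constructor
  · intro h'
    have key : ∀ j < n, c = kd n a b j → ∃ j < n, c = kd n a b j ∧ d = kd n a b (j + 1) := by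
      rintro j hj rfl
      exact ⟨j, hj, rfl, h'.uniq (parts_sp_new hn h hj)⟩
    rcases mem_sp.1 h'.1 with hc | ⟨j, hj, hc⟩
    · by_cases hca : c = a
      · exact Or.inr (key 0 (by omega) (by rw [hca, kd_zero]))
      · obtain ⟨d', hd'⟩ := exists_next hP hc
        have := h'.uniq (parts_sp_old hn h hd' hca)
        subst this
        exact Or.inl ⟨hd', hca⟩
    · exact Or.inr (key j hj hc)
  · rintro (⟨h1, h2⟩ | ⟨j, hj, rfl, rfl⟩)
    · exact parts_sp_old hn h h1 h2
    · exact parts_sp_new hn h hj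

lemma wf_zero : Wf {0} := ⟨by simp, by simp⟩

lemma wf_steps {n : ℕ} (hn : 2 ≤ n) {k : ℕ} {P Q : Finset ℝ} (h : Steps n k P Q) (hP : Wf P) :
    Wf Q := by
  induction h with
  | refl P => exact hP
  | head k P P' P'' hs _ ih =>
    obtain ⟨a, b, h, rfl⟩ := hs
    exact ih (wf_sp hn hP h)

lemma wf_std {n : ℕ} (hn : 2 ≤ n) {k : ℕ} {P : Finset ℝ} (h : IsStdSubdiv n k P) : Wf P :=
  wf_steps hn (steps_of_std h) wf_zero

lemma sp_comm {n : ℕ} (P : Finset ℝ) (a b c d : ℝ) :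
    sp n (sp n P a b) c d = sp n (sp n P c d) a b := by
  unfold sp; rw [Finset.union_assoc, Finset.union_assoc, Finset.union_comm (Finset.image _ _)]

lemma diamond {n : ℕ} (hn : 2 ≤ n) {P A B : Finset ℝ} (hA : Step n P A) (hB : Step n P B) :
    A = B ∨ ∃ C, Step n A C ∧ Step n B C := by
  obtain ⟨a, b, h, rfl⟩ := hA
  obtain ⟨c, d, h', rfl⟩ := hB
  by_cases hca : c = a
  · subst hca
    left; rw [h.uniq h']
  · right
    exact ⟨_, ⟨c, d, parts_sp_old hn h h' hca, rfl⟩,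
      ⟨a, b, parts_sp_old hn h' h (Ne.symm hca), sp_comm _ _ _ _ _⟩⟩

lemma strip {n : ℕ} (hn : 2 ≤ n) {s : ℕ} {P A B : Finset ℝ} (hB : Steps n s P B)
    (hA : Step n P A) :
    (∃ C, Steps n s A C ∧ Step n B C) ∨ (∃ s', s = s' + 1 ∧ Steps n s' A B) := by
  induction hB generalizing A with
  | refl P => exact Or.inl ⟨A, Steps.refl _, hA⟩
  | head k P P1 B h1 h2 ih =>
    rcases diamond hn hA h1 with rfl | ⟨C1, hC1, hC2⟩
    · exact Or.inr ⟨k, rfl, h2⟩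
    · rcases ih hC2 with ⟨C, h3, h4⟩ | ⟨s', rfl, h3⟩
      · exact Or.inl ⟨C, Steps.head _ _ _ _ hC1 h3, h4⟩
      · exact Or.inr ⟨_, rfl, Steps.head _ _ _ _ hC1 h3⟩

lemma join {n : ℕ} (hn : 2 ≤ n) {c s : ℕ} {P A B : Finset ℝ} (hA : Steps n c P A)
    (hB : Steps n s P B) :
    ∃ W c' s', c' ≤ c ∧ Steps n s' A W ∧ Steps n c' B W := by
  induction hA generalizing B s with
  | refl P => exact ⟨B, 0, s, le_rfl, hB, Steps.refl _⟩
  | head k P P1 A h1 h2 ih =>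
    rcases strip hn hB h1 with ⟨C, h3, h4⟩ | ⟨s', rfl, h3⟩
    · obtain ⟨W, c', s', h5, h6, h7⟩ := ih h3
      exact ⟨W, c' + 1, s', by omega, h6, Steps.head _ _ _ _ h4 h7⟩
    · obtain ⟨W, c', s', h5, h6, h7⟩ := ih h3
      exact ⟨W, c', s', by omega, h6, h7⟩

lemma card_sp {n : ℕ} (hn : 2 ≤ n) {P : Finset ℝ} {a b : ℝ} (h : Parts P a b) :
    (sp n P a b).card = P.card + (n - 1) := by
  have : sp n P a b = P ∪ (Finset.Ico 1 n).image (fun j : ℕ => kd n a b j) := by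
    ext x
    rw [mem_sp, Finset.mem_union, Finset.mem_image]
    constructor
    · rintro (hx | ⟨j, hj, rfl⟩)
      · exact Or.inl hx
      · rcases Nat.eq_zero_or_pos j with rfl | h0
        · left; rw [kd_zero]; exact h.1
        · exact Or.inr ⟨j, by simp; omega, rfl⟩
    · rintro (hx | ⟨j, hj, rfl⟩)
      · exact Or.inl hx
      · exact Or.inr ⟨j, (Finset.mem_Ico.1 hj).2, rfl⟩
  rw [this, Finset.card_union_of_disjoint, Finset.card_image_of_injective]
  · simp
  · intro i j hij
    by_contra hne
    rcases lt_or_gt_of_ne hne with h1 | h1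
    · exact absurd hij (((kd_lt hn h.lt).2 h1).ne)
    · exact absurd hij (((kd_lt hn h.lt).2 h1).ne')
  · rw [Finset.disjoint_left]
    intro x hx hx'
    obtain ⟨j, hj, rfl⟩ := Finset.mem_image.1 hx'
    obtain ⟨h1, h2⟩ := Finset.mem_Ico.1 hj
    have h3 : a < kd n a b j := by
      have := (kd_lt hn h.lt (i := 0) (j := j)).2 h1
      rwa [kd_zero] at this
    have h4 : kd n a b j < b := by
      have := (kd_lt hn h.lt (i := j) (j := n)).2 h2
      rwa [kd_n hn] at this
    have := h.2.2.2 _ (Finset.mem_insert_of_mem hx) h3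
    linarith

lemma card_std {n : ℕ} (hn : 2 ≤ n) {k : ℕ} {P : Finset ℝ} (h : IsStdSubdiv n k P) :
    P.card = k * (n - 1) + 1 := by
  induction h with
  | base => simp
  | step k P a b hP ha hb hab hm ih =>
    have := card_sp hn (P := P) (a := a) (b := b) ⟨ha, hb, hab, hm⟩
    unfold sp at this
    rw [this, ih]; ring

/-! ### Affine maps between parts -/

def AffMap (f : Circle ≃ₜ Circle) (a b a' b' : ℝ) : Prop :=
  ∀ t : ℝ, 0 ≤ t → t ≤ 1 → f ((a + t * (b - a) : ℝ) : Circle) = ((a' + t * (b' - a') : ℝ) : Circle)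

lemma mul_app (f g : Circle ≃ₜ Circle) (x : Circle) : (f * g) x = f (g x) := rfl

lemma inv_app_app (f : Circle ≃ₜ Circle) (x : Circle) : f⁻¹ (f x) = x := f.symm_apply_apply x

lemma app_inv_app (f : Circle ≃ₜ Circle) (x : Circle) : f (f⁻¹ x) = x := f.apply_symm_apply x

lemma one_app (x : Circle) : (1 : Circle ≃ₜ Circle) x = x := rfl

lemma AffMap.comp {f g : Circle ≃ₜ Circle} {a b c d p q : ℝ} (hg : AffMap g c d p q)
    (hf : AffMap f a b c d) : AffMap (g * f) a b p q := by
  intro t h0 h1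
  rw [mul_app, hf t h0 h1, hg t h0 h1]

lemma AffMap.inv {f : Circle ≃ₜ Circle} {a b c d : ℝ} (hf : AffMap f a b c d) :
    AffMap f⁻¹ c d a b := by
  intro t h0 h1
  rw [← hf t h0 h1, inv_app_app]

lemma AffMap.one {a b : ℝ} : AffMap 1 a b a b := fun _ _ _ => rfl

lemma AffMap.left {f : Circle ≃ₜ Circle} {a b c d : ℝ} (hf : AffMap f a b c d) :
    f (a : Circle) = (c : Circle) := by
  have := hf 0 le_rfl zero_le_one
  simpa using this

lemma AffMap.right {f : Circle ≃ₜ Circle} {a b c d : ℝ} (hf : AffMap f a b c d) :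
    f (b : Circle) = (d : Circle) := by
  have := hf 1 zero_le_one le_rfl
  simpa using this

lemma AffMap.kid {n : ℕ} (hn : 2 ≤ n) {f : Circle ≃ₜ Circle} {a b c d : ℝ} (hf : AffMap f a b c d)
    {j : ℕ} (hj : j < n) :
    AffMap f (kd n a b j) (kd n a b (j + 1)) (kd n c d j) (kd n c d (j + 1)) := by
  intro t h0 h1
  have hn0 : (0 : ℝ) < n := by positivity
  have hj' : (j : ℝ) + 1 ≤ n := by exact_mod_cast hj
  have := hf ((j + t) / n) (by positivity) (by rw [div_le_one hn0]; linarith)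
  have e : ∀ u v : ℝ, kd n u v j + t * (kd n u v (j + 1) - kd n u v j) =
      u + (j + t) / n * (v - u) := by
    intro u v
    unfold kd
    push_cast
    field_simp; ring
  rw [e, e, this]

lemma coe_eq {x y : ℝ} : (x : Circle) = (y : Circle) ↔ ∃ z : ℤ, x = y + z := by
  rw [← sub_eq_zero, ← AddCircle.coe_sub, AddCircle.coe_eq_zero_iff]
  constructor
  · rintro ⟨z, hz⟩
    exact ⟨z, by simp at hz; linarith⟩
  · rintro ⟨z, hz⟩
    exact ⟨z, by simp; linarith⟩

lemma coe_int (z : ℤ) : ((z : ℝ) : Circle) = 0 := by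
  have : ((z : ℝ) : Circle) = ((0 : ℝ) : Circle) := coe_eq.2 ⟨z, by simp⟩
  rw [this]; rfl

lemma coe_inj {x y : ℝ} (hx : 0 ≤ x) (hx1 : x < 1) (hy : 0 ≤ y) (hy1 : y < 1)
    (h : (x : Circle) = (y : Circle)) : x = y := by
  obtain ⟨z, hz⟩ := coe_eq.1 h
  have h1 : (z : ℝ) < 1 := by linarith
  have h2 : (-1 : ℝ) < z := by linarith
  have h3 : z < 1 := by exact_mod_cast h1
  have h4 : -1 < z := by exact_mod_cast h2
  have : z = 0 := by omega
  subst this; simpa using hz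

lemma coe_surj (x : Circle) : ∃ y : ℝ, 0 ≤ y ∧ y < 1 ∧ (y : Circle) = x := by
  induction x using QuotientAddGroup.induction_on with
  | H x =>
    refine ⟨Int.fract x, Int.fract_nonneg x, Int.fract_lt_one x, coe_eq.2 ⟨-⌊x⌋, ?_⟩⟩
    rw [Int.fract]; push_cast; ring

def Good (f : Circle ≃ₜ Circle) (P Q : Finset ℝ) : Prop :=
  (∀ a b, Parts P a b → ∃ a' b', Parts Q a' b' ∧ AffMap f a b a' b') ∧
  (∀ a' b', Parts Q a' b' → ∃ a b, Parts P a b ∧ AffMap f a b a' b')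

lemma Good.inv {f : Circle ≃ₜ Circle} {P Q : Finset ℝ} (h : Good f P Q) : Good f⁻¹ Q P := by
  refine ⟨fun a b hab => ?_, fun a b hab => ?_⟩
  · obtain ⟨c, d, h1, h2⟩ := h.2 a b hab
    exact ⟨c, d, h1, h2.inv⟩
  · obtain ⟨c, d, h1, h2⟩ := h.1 a b hab
    exact ⟨c, d, h1, h2.inv⟩

lemma Good.comp {f g : Circle ≃ₜ Circle} {P Q R : Finset ℝ} (hg : Good g Q R) (hf : Good f P Q) :
    Good (g * f) P R := by
  refine ⟨fun a b hab => ?_, fun a b hab => ?_⟩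
  · obtain ⟨c, d, h1, h2⟩ := hf.1 a b hab
    obtain ⟨p, q, h3, h4⟩ := hg.1 c d h1
    exact ⟨p, q, h3, h4.comp h2⟩
  · obtain ⟨c, d, h1, h2⟩ := hg.2 a b hab
    obtain ⟨p, q, h3, h4⟩ := hf.2 c d h1
    exact ⟨p, q, h3, h2.comp h4⟩

lemma Good.one {P : Finset ℝ} : Good 1 P P :=
  ⟨fun a b h => ⟨a, b, h, AffMap.one⟩, fun a b h => ⟨a, b, h, AffMap.one⟩⟩

/-- A one-directional version suffices. -/
lemma good_of_forward {f : Circle ≃ₜ Circle} {P Q : Finset ℝ} (hP : Wf P) (hQ : Wf Q)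
    (h : ∀ a b, Parts P a b → ∃ a' b', Parts Q a' b' ∧ AffMap f a b a' b') : Good f P Q := by
  refine ⟨h, fun a' b' hab => ?_⟩
  obtain ⟨x, hx0, hx1, hx⟩ := coe_surj (f⁻¹ (a' : Circle))
  obtain ⟨a, b, hp, h1, h2⟩ := exists_part hP hx0 hx1
  obtain ⟨c, d, hq, hA⟩ := h a b hp
  have hlt := hp.lt
  have hlt' := hq.lt
  have hfx : f (x : Circle) = (a' : Circle) := by rw [hx, app_inv_app]
  have ht0 : 0 ≤ (x - a) / (b - a) := div_nonneg (by linarith) (by linarith)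
  have ht1 : (x - a) / (b - a) < 1 := by rw [div_lt_one (by linarith)]; linarith
  have h3 := hA ((x - a) / (b - a)) ht0 ht1.le
  rw [div_mul_cancel₀ _ (by linarith : b - a ≠ 0), add_sub_cancel, hfx] at h3
  set t := (x - a) / (b - a)
  have h4 : c + t * (d - c) < d := by nlinarith
  have h5 : c ≤ c + t * (d - c) := by nlinarith
  have h6 := coe_inj (hab.nonneg hQ) (hab.lt.trans_le (hab.le_one hQ))
    ((hq.nonneg hQ).trans h5) (h4.trans_le (hq.le_one hQ)) h3
  have := hab.eq_of_overlap hq le_rfl hab.lt (by linarith) (by linarith)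
  rw [this.1, this.2] at hA
  exact ⟨a, b, hp, hA⟩

lemma parts_inj {f : Circle ≃ₜ Circle} {P : Finset ℝ} (hP : Wf P) {a b c d p q q' : ℝ}
    (h : Parts P a b) (h' : Parts P c d) (hf : AffMap f a b p q) (hf' : AffMap f c d p q') :
    a = c := by
  have : (a : Circle) = (c : Circle) := f.injective (by rw [hf.left, hf'.left])
  exact coe_inj (h.nonneg hP) (h.lt.trans_le (h.le_one hP)) (h'.nonneg hP)
    (h'.lt.trans_le (h'.le_one hP)) this

lemma Good.split {n : ℕ} (hn : 2 ≤ n) {f : Circle ≃ₜ Circle} {P Q : Finset ℝ} (hP : Wf P)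
    (hQ : Wf Q) (h : Good f P Q) {a b c d : ℝ} (hp : Parts P a b) (hq : Parts Q c d)
    (hA : AffMap f a b c d) : Good f (sp n P a b) (sp n Q c d) := by
  apply good_of_forward (wf_sp hn hP hp) (wf_sp hn hQ hq)
  intro u v huv
  rcases (parts_sp hn hP hp).1 huv with ⟨h1, h2⟩ | ⟨j, hj, rfl, rfl⟩
  · obtain ⟨p, q, h3, h4⟩ := h.1 u v h1
    refine ⟨p, q, parts_sp_old hn hq h3 ?_, h4⟩
    rintro rfl
    exact h2 (parts_inj hP h1 hp h4 hA)
  · exact ⟨_, _, parts_sp_new hn hq hj, hA.kid hn hj⟩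

lemma Good.steps {n : ℕ} (hn : 2 ≤ n) {f : Circle ≃ₜ Circle} {P P' : Finset ℝ} {s : ℕ}
    (hs : Steps n s P P') : ∀ {Q : Finset ℝ}, Wf P → Wf Q → Good f P Q →
      ∃ Q', Steps n s Q Q' ∧ Good f P' Q' := by
  induction hs with
  | refl P => exact fun _ _ h => ⟨_, Steps.refl _, h⟩
  | head k P P1 P2 h1 h2 ih =>
    intro Q hP hQ h
    obtain ⟨a, b, hp, rfl⟩ := h1
    obtain ⟨c, d, hq, hA⟩ := h.1 a b hp
    obtain ⟨Q', h3, h4⟩ := ih (wf_sp hn hP hp) (wf_sp hn hQ hq) (h.split hn hP hQ hp hq hA)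
    exact ⟨Q', Steps.head _ _ _ _ ⟨c, d, hq, rfl⟩ h3, h4⟩

/-- there is a pair with `k` carets -/
def HasPair (n k : ℕ) (f : Circle ≃ₜ Circle) : Prop :=
  ∃ P Q, IsStdSubdiv n k P ∧ IsStdSubdiv n k Q ∧ Good f P Q

lemma HasPair.inv {n k : ℕ} {f : Circle ≃ₜ Circle} (h : HasPair n k f) : HasPair n k f⁻¹ := by
  obtain ⟨P, Q, h1, h2, h3⟩ := h
  exact ⟨Q, P, h2, h1, h3.inv⟩

lemma HasPair.one {n : ℕ} : HasPair n 0 1 := ⟨_, _, IsStdSubdiv.base, IsStdSubdiv.base, Good.one⟩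

lemma HasPair.mul {n : ℕ} (hn : 2 ≤ n) {c k : ℕ} {f g : Circle ≃ₜ Circle} (hg : HasPair n c g)
    (hf : HasPair n k f) : ∃ l ≤ k + c, HasPair n l (g * f) := by
  obtain ⟨P, Q, hP, hQ, h⟩ := hf
  obtain ⟨A, B, hA, hB, h'⟩ := hg
  obtain ⟨W, c', s', hc, hAW, hQW⟩ := join hn (steps_of_std hA) (steps_of_std hQ)
  obtain ⟨P', h1, h2⟩ := h.inv.steps hn hQW (wf_std hn hQ) (wf_std hn hP)
  obtain ⟨B', h3, h4⟩ := h'.steps hn hAW (wf_std hn hA) (wf_std hn hB)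
  have e1 := std_of_steps h1 hP
  have e2 := std_of_steps h3 hB
  have e3 := std_of_steps hQW hQ
  have e4 := std_of_steps hAW hA
  have : c + s' = k + c' := by
    have h5 := card_std hn e3
    have h6 := card_std hn e4
    rw [h6] at h5
    have : 0 < n - 1 := by omega
    exact Nat.eq_of_mul_eq_mul_right this (by omega)
  rw [this] at e2
  have h2' := h2.inv
  rw [inv_inv] at h2'
  exact ⟨k + c', by omega, P', B', e1, e2, h4.comp h2'⟩

lemma good_circlePts {f : Circle ≃ₜ Circle} {P Q : Finset ℝ} (hP : Wf P) (hQ : Wf Q)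
    (h : Good f P Q) : f '' circlePts P = circlePts Q := by
  ext x
  constructor
  · rintro ⟨_, ⟨a, ha, rfl⟩, rfl⟩
    obtain ⟨b, hab⟩ := exists_next hP ha
    obtain ⟨c, d, h1, h2⟩ := h.1 a b hab
    exact ⟨c, h1.1, h2.left.symm⟩
  · rintro ⟨c, hc, rfl⟩
    obtain ⟨d, hcd⟩ := exists_next hQ hc
    obtain ⟨a, b, h1, h2⟩ := h.2 c d hcd
    exact ⟨a, ⟨a, h1.1, rfl⟩, h2.left⟩

lemma good_affine {f : Circle ≃ₜ Circle} {P Q : Finset ℝ}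
    (h : Good f P Q) : AffineOnParts P f := by
  intro a ha b hb
  obtain ⟨c, d, h1, h2⟩ := h.1 a b ⟨ha, hb⟩
  have hlt : 0 < b - a := sub_pos.2 hb.2.1
  refine ⟨(d - c) / (b - a), c - a * ((d - c) / (b - a)), fun x hx => ?_⟩
  have := h2 ((x - a) / (b - a)) (div_nonneg (by linarith [hx.1]) hlt.le)
    (by rw [div_le_one hlt]; linarith [hx.2])
  rw [div_mul_cancel₀ _ hlt.ne', add_sub_cancel] at this
  rw [this]; congr 1; field_simp; ring

lemma card_good {n : ℕ} (hn : 2 ≤ n) {f : Circle ≃ₜ Circle} {P Q : Finset ℝ} {k l : ℕ}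
    (hP : IsStdSubdiv n k P) (hQ : IsStdSubdiv n l Q) (h : Good f P Q) : k = l := by
  have key : ∀ R : Finset ℝ, Wf R → (circlePts R).ncard = R.card := by
    intro R hR
    unfold circlePts
    rw [Set.InjOn.ncard_image, Set.ncard_coe_finset]
    intro x hx y hy hxy
    exact coe_inj (hR.2 x hx).1 (hR.2 x hx).2 (hR.2 y hy).1 (hR.2 y hy).2 hxy
  have h1 := good_circlePts (wf_std hn hP) (wf_std hn hQ) h
  have h2 : (circlePts P).ncard = (circlePts Q).ncard := by
    rw [← h1, Set.ncard_image_of_injective _ f.injective]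
  rw [key _ (wf_std hn hP), key _ (wf_std hn hQ), card_std hn hP, card_std hn hQ] at h2
  have : 0 < n - 1 := by omega
  exact Nat.eq_of_mul_eq_mul_right this (by omega)

/-! ### Orientation -/

def Orient (f : Circle ≃ₜ Circle) : Prop :=
  ∃ F : ℝ → ℝ, StrictMono F ∧ IsLift f F ∧ ∀ x, F (x + 1) = F x + 1

lemma lift_int {F : ℝ → ℝ} (h : ∀ x, F (x + 1) = F x + 1) (x : ℝ) (z : ℤ) : F (x + z) = F x + z := by
  induction z using Int.induction_on with
  | zero => simp
  | succ i ih => push_cast at *; rw [← add_assoc, h, ih]; ring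
  | pred i ih =>
    have := h (x + ((-(i:ℤ) - 1 : ℤ) : ℝ))
    push_cast at *
    rw [show x + (-(i:ℝ) - 1) + 1 = x + -(i:ℝ) by ring, ih] at this
    linarith

lemma lift_surj {f : Circle ≃ₜ Circle} {F : ℝ → ℝ} (hl : IsLift f F)
    (h : ∀ x, F (x + 1) = F x + 1) : Function.Surjective F := by
  intro y
  obtain ⟨x, hx0, hx1, hx⟩ := coe_surj (f⁻¹ (y : Circle))
  have : (y : Circle) = (F x : Circle) := by rw [← hl, hx, app_inv_app]
  obtain ⟨z, hz⟩ := coe_eq.1 this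
  exact ⟨x + z, by rw [lift_int h, hz]⟩

lemma Orient.mul {f g : Circle ≃ₜ Circle} (hf : Orient f) (hg : Orient g) : Orient (f * g) := by
  obtain ⟨F, h1, h2, h3⟩ := hf
  obtain ⟨G, h4, h5, h6⟩ := hg
  refine ⟨F ∘ G, h1.comp h4, fun x => ?_, fun x => ?_⟩
  · rw [mul_app, h5, h2]; rfl
  · simp [h6, h3]

lemma Orient.one : Orient 1 := ⟨id, strictMono_id, fun _ => rfl, fun _ => rfl⟩

lemma Orient.inv {f : Circle ≃ₜ Circle} (hf : Orient f) : Orient f⁻¹ := by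
  obtain ⟨F, h1, h2, h3⟩ := hf
  have hs := lift_surj h2 h3
  let e := h1.orderIsoOfSurjective F hs
  have he : ∀ x, F (e.symm x) = x := fun x => e.apply_symm_apply x
  refine ⟨e.symm, e.symm.strictMono, fun x => ?_, fun x => ?_⟩
  · apply f.injective
    rw [app_inv_app, h2, he]
  · apply h1.injective
    rw [he, h3, he]

lemma orient_Tn {n : ℕ} {f : Circle ≃ₜ Circle} (hf : f ∈ Tn n) : Orient f := by
  unfold Tn at hf
  induction hf using Subgroup.closure_induction with
  | mem x hx =>
    obtain ⟨_, F, h1, h2, h3⟩ := hx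
    exact ⟨F, h1, h2, h3.1⟩
  | one => exact Orient.one
  | mul x y _ _ h1 h2 => exact h1.mul h2
  | inv x _ h => exact h.inv

lemma no_between {Q : Finset ℝ} (hQ : Wf Q) {a b q : ℝ} {z : ℤ} (h : Parts Q a b) (hq : q ∈ Q)
    (h1 : a < q + z) : b ≤ q + z := by
  by_contra h2
  push Not at h2
  have h3 := h.nonneg hQ
  have h4 := h.le_one hQ
  have h5 := hQ.2 q hq
  have h6 : (z : ℝ) < 1 := by linarith
  have h7 : (-1 : ℝ) < z := by linarith
  have h6 : z < 1 := by exact_mod_cast h6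
  have h7 : -1 < z := by exact_mod_cast h7
  have : z = 0 := by omega
  subst this
  simp only [Int.cast_zero, add_zero] at h1 h2
  have := h.2.2.2 q (Finset.mem_insert_of_mem hq) h1
  linarith

lemma right_mem {Q : Finset ℝ} (hQ : Wf Q) {a b : ℝ} (h : Parts Q a b) :
    ∃ q ∈ Q, ∃ z : ℤ, b = q + z := by
  rcases Finset.mem_insert.1 h.2.1 with h | h
  · exact ⟨0, hQ.1, 1, by simp [h]⟩
  · exact ⟨b, h, 0, by simp⟩

lemma good_of_affine {f : Circle ≃ₜ Circle} (hf : Orient f) {P Q : Finset ℝ} (hP : Wf P) (hQ : Wf Q)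
    (hA : AffineOnParts P f) (hI : f '' circlePts P = circlePts Q) : Good f P Q := by
  obtain ⟨F, h1, h2, h3⟩ := hf
  have hs := lift_surj h2 h3
  have hc : Continuous F := (h1.orderIsoOfSurjective F hs).continuous
  apply good_of_forward hP hQ
  intro a b hab
  obtain ⟨s, c, hsc⟩ := hA a hab.1 b hab.2
  have hPQ : ∀ p ∈ P, ∃ q ∈ Q, ∃ z : ℤ, F p = q + z := by
    intro p hp
    have : f (p : Circle) ∈ circlePts Q := by
      rw [← hI]; exact ⟨_, ⟨p, hp, rfl⟩, rfl⟩
    obtain ⟨q, hq, hq'⟩ := this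
    rw [h2] at hq'
    obtain ⟨z, hz⟩ := coe_eq.1 hq'.symm
    exact ⟨q, hq, z, hz⟩
  obtain ⟨a', ha', z, hz⟩ := hPQ a hab.1
  obtain ⟨b', hab'⟩ := exists_next hQ ha'
  have hFb : F b = b' + z := by
    apply le_antisymm
    · obtain ⟨q, hq, w, hw⟩ := right_mem hQ hab'
      have : (q : Circle) ∈ f '' circlePts P := by rw [hI]; exact ⟨q, hq, rfl⟩
      obtain ⟨_, ⟨p, hp, rfl⟩, hpq⟩ := this
      have hpq : ((F p : ℝ) : Circle) = (q : Circle) := by rw [← h2]; exact hpq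
      obtain ⟨y, hy⟩ := coe_eq.1 hpq
      have e : b' + z = F (p + ((w + z - y : ℤ) : ℝ)) := by
        rw [lift_int h3, hy, hw]; push_cast; ring
      rw [e]
      apply h1.monotone
      apply no_between hP hab hp
      rw [← h1.lt_iff_lt, ← e, hz]
      linarith [hab'.lt]
    · obtain ⟨p, hp, w, hw⟩ := right_mem hP hab
      obtain ⟨q, hq, y, hy⟩ := hPQ p hp
      have h4 : F a < F b := h1 hab.lt
      have e : F b = q + ((y + w - z : ℤ) : ℝ) + z := by
        rw [hw, lift_int h3, hy]; push_cast; ring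
      have := no_between hQ hab' hq (z := y + w - z) (by linarith)
      linarith
  -- F is affine on [a, b]
  have hconst : ∀ x ∈ Set.Icc a b, F x - (s * x + c) = F a - (s * a + c) := by
    intro x hx
    have hpre : IsPreconnected (Set.Icc a b) := isPreconnected_Icc
    have hex : ∀ x ∈ Set.Icc a b, ∃ z : ℤ, F x - (s * x + c) = z := by
      intro x hx
      have := hsc x hx
      rw [h2] at this
      obtain ⟨z, hz⟩ := coe_eq.1 this
      exact ⟨z, by linarith⟩
    have hcont : Continuous (fun x => F x - (s * x + c)) := by fun_prop
    by_contra hne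
    obtain ⟨z1, hz1⟩ := hex x hx
    obtain ⟨z2, hz2⟩ := hex a (Set.left_mem_Icc.2 hab.lt.le)
    have himg := (hpre.image _ hcont.continuousOn).ordConnected
    rw [hz1, hz2] at hne
    have hne' : z1 ≠ z2 := by exact_mod_cast hne
    have hm1 : (z1 : ℝ) ∈ (fun x => F x - (s * x + c)) '' Set.Icc a b := ⟨x, hx, hz1⟩
    have hm2 : (z2 : ℝ) ∈ (fun x => F x - (s * x + c)) '' Set.Icc a b :=
      ⟨a, Set.left_mem_Icc.2 hab.lt.le, hz2⟩
    have final : ∀ u v : ℤ, u < v →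
        (u : ℝ) ∈ (fun x => F x - (s * x + c)) '' Set.Icc a b →
        (v : ℝ) ∈ (fun x => F x - (s * x + c)) '' Set.Icc a b → False := by
      intro u v huv hu hv
      have huv' : (u : ℝ) + 1 ≤ v := by exact_mod_cast huv
      obtain ⟨y, hy, hy'⟩ := himg.out hu hv (show (u : ℝ) + 1 / 2 ∈ Set.Icc (u : ℝ) v from
        ⟨by linarith, by linarith⟩)
      obtain ⟨w, hw⟩ := hex y hy
      simp only [hw] at hy'
      have h5 : (u : ℝ) < w := by linarith
      have h6 : (w : ℝ) < u + 1 := by linarith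
      have h5 : u < w := by exact_mod_cast h5
      have h6 : w < u + 1 := by exact_mod_cast h6
      omega
    rcases lt_or_gt_of_ne hne' with h | h
    · exact final _ _ h hm1 hm2
    · exact final _ _ h hm2 hm1
  refine ⟨a', b', hab', fun t ht0 ht1 => ?_⟩
  rw [h2]
  have hlt := hab.lt
  have e1 := hconst (a + t * (b - a)) ⟨by nlinarith, by nlinarith⟩
  have e2 := hconst b (Set.right_mem_Icc.2 hlt.le)
  refine coe_eq.2 ⟨z, ?_⟩
  have : s * (b - a) = b' - a' := by linarith
  have : s * (t * (b - a)) = t * (b' - a') := by rw [← this]; ring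
  linarith

/-- rigidity -/
lemma eq_one_of_good {f : Circle ≃ₜ Circle} (hf : Orient f) {P : Finset ℝ} (hP : Wf P)
    (h : Good f P P) (h0 : f 0 = 0) : f = 1 := by
  obtain ⟨F, h1, h2, h3⟩ := hf
  have hF0 : ∃ z : ℤ, F 0 = z := by
    have := h2 0
    rw [AddCircle.coe_zero, h0] at this
    have h4 : ((F 0 : ℝ) : Circle) = ((0:ℝ) : Circle) := by rw [← this]; simp
    obtain ⟨z, hz⟩ := coe_eq.1 h4
    exact ⟨z, by simpa using hz⟩
  obtain ⟨z, hz⟩ := hF0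
  have hmem : ∀ p : P, F p - z ∈ P := by
    rintro ⟨p, hp⟩
    obtain ⟨b, hb⟩ := exists_next hP hp
    obtain ⟨a', b', h4, h5⟩ := h.1 p b hb
    have h6 := h5.left
    rw [h2] at h6
    have h7 : ((F p - z : ℝ) : Circle) = (a' : Circle) := by
      rw [← h6]; exact coe_eq.2 ⟨-z, by push_cast; ring⟩
    have h8 : F 0 ≤ F p := h1.monotone (hP.2 p hp).1
    have h9 : F p < F (0 + 1) := h1 (by simpa using (hP.2 p hp).2)
    rw [h3] at h9
    have := coe_inj (by linarith) (by linarith) (h4.nonneg hP) (h4.lt.trans_le (h4.le_one hP)) h7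
    simp only [this]
    exact h4.1
  let φ : P → P := fun p => ⟨F p - z, hmem p⟩
  have hφ : StrictMono φ := fun p q hpq => by
    show F p - z < F q - z
    have := h1 (show (p : ℝ) < q from hpq)
    linarith
  have hfix : ∀ p ∈ P, f (p : Circle) = (p : Circle) := by
    intro p hp
    have h4 : (⟨p, hp⟩ : P) ≤ φ ⟨p, hp⟩ := hφ.le_apply
    have h5 : φ ⟨p, hp⟩ ≤ (⟨p, hp⟩ : P) := hφ.apply_le
    have h6 : F p - z = p := congrArg Subtype.val (le_antisymm h5 h4)
    rw [h2]
    exact coe_eq.2 ⟨z, by linarith⟩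
  ext x
  obtain ⟨y, hy0, hy1, rfl⟩ := coe_surj x
  obtain ⟨a, b, hp, h4, h5⟩ := exists_part hP hy0 hy1
  obtain ⟨a', b', hp', h6⟩ := h.1 a b hp
  have h7 : a' = a := by
    have := h6.left
    rw [hfix a hp.1] at this
    exact (coe_inj (hp.nonneg hP) (hp.lt.trans_le (hp.le_one hP)) (hp'.nonneg hP)
      (hp'.lt.trans_le (hp'.le_one hP)) this).symm
  subst h7
  have := hp.uniq hp'
  subst this
  have hlt : 0 < b - a' := sub_pos.2 hp.lt
  have h8 := h6 ((y - a') / (b - a')) (div_nonneg (by linarith) hlt.le)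
    (by rw [div_le_one hlt]; linarith)
  rw [div_mul_cancel₀ _ hlt.ne', add_sub_cancel] at h8
  rw [h8]; rfl

/-! ### The right vine -/

def vn (n : ℕ) : ℕ → ℝ
  | 0 => 0
  | i + 1 => vn n i + 1 / (n : ℝ) ^ (i / (n - 1) + 1)

lemma vn_zero {n : ℕ} : vn n 0 = 0 := rfl
lemma vn_succ {n i : ℕ} : vn n (i + 1) = vn n i + 1 / (n : ℝ) ^ (i / (n - 1) + 1) := rfl

lemma vn_strictMono {n : ℕ} (hn : 2 ≤ n) : StrictMono (vn n) := by
  apply strictMono_nat_of_lt_succ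
  intro i
  rw [vn_succ]
  have : (0 : ℝ) < n := by positivity
  have : 0 < 1 / (n : ℝ) ^ (i / (n - 1) + 1) := by positivity
  linarith

lemma vn_add {n : ℕ} (hn : 2 ≤ n) (k e : ℕ) (he : e ≤ n - 1) :
    vn n ((n - 1) * k + e) = vn n ((n - 1) * k) + e / (n : ℝ) ^ (k + 1) := by
  induction e with
  | zero => simp
  | succ e ih =>
    rw [← add_assoc, vn_succ, ih (by omega)]
    have : ((n - 1) * k + e) / (n - 1) = k := by
      rw [Nat.mul_add_div (by omega), Nat.div_eq_of_lt (by omega)]; rfl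
    rw [this]; push_cast; ring

lemma vn_mul {n : ℕ} (hn : 2 ≤ n) (k : ℕ) : vn n ((n - 1) * k) = 1 - 1 / (n : ℝ) ^ k := by
  have hn0 : (n : ℝ) ≠ 0 := by positivity
  induction k with
  | zero => simp [vn_zero]
  | succ k ih =>
    rw [Nat.mul_succ, vn_add hn k _ le_rfl, ih, Nat.cast_sub (by omega)]
    field_simp; push_cast; ring

lemma vn_shift {n : ℕ} (hn : 2 ≤ n) (i : ℕ) : vn n (i + (n - 1)) = 1 - (1 - vn n i) / n := by
  have hn0 : (n : ℝ) ≠ 0 := by positivity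
  induction i with
  | zero =>
    have := vn_mul hn 1
    simp only [mul_one, pow_one] at this
    rw [zero_add, this, vn_zero]; simp
  | succ i ih =>
    rw [show i + 1 + (n - 1) = i + (n - 1) + 1 by ring, vn_succ, vn_succ, ih,
      Nat.add_div_right _ (by omega)]
    field_simp; ring

lemma vn_lt_one {n : ℕ} (hn : 2 ≤ n) (i : ℕ) : vn n i < 1 := by
  have h1 : vn n i ≤ vn n ((n - 1) * i) :=
    (vn_strictMono hn).monotone (Nat.le_mul_of_pos_left i (by omega))
  rw [vn_mul hn] at h1
  have : (0 : ℝ) < n := by positivity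
  have : 0 < 1 / (n : ℝ) ^ i := by positivity
  linarith

lemma vn_nonneg {n : ℕ} (hn : 2 ≤ n) (i : ℕ) : 0 ≤ vn n i := by
  have := (vn_strictMono hn).monotone (Nat.zero_le i)
  rwa [vn_zero] at this

def VV (n : ℕ) : ℕ → Finset ℝ
  | 0 => {0}
  | k + 1 => sp n (VV n k) (vn n ((n - 1) * k)) 1

lemma kd_vine {n : ℕ} (hn : 2 ≤ n) (k j : ℕ) (hj : j ≤ n - 1) :
    kd n (vn n ((n - 1) * k)) 1 j = vn n ((n - 1) * k + j) := by
  have hn0 : (n : ℝ) ≠ 0 := by positivity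
  rw [vn_add hn k j hj, vn_mul hn, kd]
  field_simp; ring

lemma vine_aux {n : ℕ} (hn : 2 ≤ n) (k : ℕ) : Wf (VV n k) ∧ ∀ c d, Parts (VV n k) c d ↔
    (∃ i < (n - 1) * k, c = vn n i ∧ d = vn n (i + 1)) ∨ (c = vn n ((n - 1) * k) ∧ d = 1) := by
  induction k with
  | zero =>
    refine ⟨wf_zero, fun c d => ?_⟩
    have h01 : Parts (VV n 0) 0 1 := by
      refine ⟨by simp [VV], by simp, by norm_num, ?_⟩
      intro c hc h
      simp [VV] at hc
      rcases hc with rfl | rfl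
      · exact le_rfl
      · exact absurd h (lt_irrefl _)
    constructor
    · intro h
      have hc : c = 0 := by simpa [VV] using h.1
      subst hc
      right
      exact ⟨by simp [vn_zero], h.uniq h01⟩
    · rintro (⟨i, hi, _⟩ | ⟨rfl, rfl⟩)
      · simp at hi
      · simpa [vn_zero] using h01
  | succ k ih =>
    obtain ⟨hw, ih⟩ := ih
    have hp : Parts (VV n k) (vn n ((n - 1) * k)) 1 := (ih _ _).2 (Or.inr ⟨rfl, rfl⟩)
    refine ⟨wf_sp hn hw hp, fun c d => ?_⟩
    show Parts (sp n (VV n k) (vn n ((n - 1) * k)) 1) c d ↔ _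
    rw [parts_sp hn hw hp, ih]
    have hm : (n - 1) * (k + 1) = (n - 1) * k + (n - 1) := Nat.mul_succ _ _
    constructor
    · rintro (⟨⟨i, hi, rfl, rfl⟩ | ⟨rfl, rfl⟩, hne⟩ | ⟨j, hj, rfl, rfl⟩)
      · exact Or.inl ⟨i, by omega, rfl, rfl⟩
      · exact absurd rfl hne
      · rcases Nat.lt_or_ge j (n - 1) with h | h
        · exact Or.inl ⟨(n - 1) * k + j, by omega, kd_vine hn k j h.le, kd_vine hn k (j + 1) h⟩
        · have : j = n - 1 := by omega
          subst this
          refine Or.inr ⟨?_, ?_⟩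
          · rw [kd_vine hn k _ le_rfl, hm]
          · rw [show n - 1 + 1 = n by omega, kd_n hn]
    · rintro (⟨i, hi, rfl, rfl⟩ | ⟨rfl, rfl⟩)
      · rcases Nat.lt_or_ge i ((n - 1) * k) with h | h
        · exact Or.inl ⟨Or.inl ⟨i, h, rfl, rfl⟩, ((vn_strictMono hn) h).ne⟩
        · obtain ⟨j, rfl⟩ := Nat.exists_eq_add_of_le h
          refine Or.inr ⟨j, by omega, (kd_vine hn k j (by omega)).symm,
            (kd_vine hn k (j + 1) (by omega)).symm⟩
      · refine Or.inr ⟨n - 1, by omega, ?_, ?_⟩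
        · rw [kd_vine hn k _ le_rfl, hm]
        · rw [show n - 1 + 1 = n by omega, kd_n hn]

lemma wf_vine {n : ℕ} (hn : 2 ≤ n) (k : ℕ) : Wf (VV n k) := (vine_aux hn k).1

lemma parts_vine {n : ℕ} (hn : 2 ≤ n) {k : ℕ} {c d : ℝ} : Parts (VV n k) c d ↔
    (∃ i < (n - 1) * k, c = vn n i ∧ d = vn n (i + 1)) ∨ (c = vn n ((n - 1) * k) ∧ d = 1) :=
  (vine_aux hn k).2 c d

lemma step_vine {n : ℕ} (hn : 2 ≤ n) (k : ℕ) : Step n (VV n k) (VV n (k + 1)) :=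
  ⟨_, _, (parts_vine hn).2 (Or.inr ⟨rfl, rfl⟩), rfl⟩

lemma std_vine {n : ℕ} (hn : 2 ≤ n) (k : ℕ) : IsStdSubdiv n k (VV n k) := by
  induction k with
  | zero => exact IsStdSubdiv.base
  | succ k ih => exact std_of_steps (Steps.single (step_vine hn k)) ih

/-- splitting the `i`-th part of the vine -/
def vs (n k i : ℕ) : Finset ℝ := sp n (VV n k) (vn n i) (vn n (i + 1))

lemma part_v {n : ℕ} (hn : 2 ≤ n) {k i : ℕ} (hi : i < (n - 1) * k) :
    Parts (VV n k) (vn n i) (vn n (i + 1)) := (parts_vine hn).2 (Or.inl ⟨i, hi, rfl, rfl⟩)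

structure XSpec (n i : ℕ) (f : Circle ≃ₜ Circle) : Prop where
  fix : ∀ l < i, AffMap f (vn n l) (vn n (l + 1)) (vn n l) (vn n (l + 1))
  kid : ∀ j < n, AffMap f (kd n (vn n i) (vn n (i + 1)) j) (kd n (vn n i) (vn n (i + 1)) (j + 1))
    (vn n (i + j)) (vn n (i + j + 1))
  shift : ∀ l, i < l → AffMap f (vn n l) (vn n (l + 1)) (vn n (l + (n - 1))) (vn n (l + (n - 1) + 1))
  tail : ∀ k, i < (n - 1) * k → AffMap f (vn n ((n - 1) * k)) 1 (vn n ((n - 1) * (k + 1))) 1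

lemma XSpec.zero {n i : ℕ} (hn : 2 ≤ n) {f : Circle ≃ₜ Circle} (h : XSpec n i f) : f 0 = 0 := by
  rcases Nat.eq_zero_or_pos i with rfl | hi
  · have := (h.kid 0 (by omega)).left
    rw [kd_zero] at this
    simpa [vn_zero] using this
  · have := (h.fix 0 hi).left
    simpa [vn_zero] using this

lemma XSpec.good {n i k : ℕ} (hn : 2 ≤ n) {f : Circle ≃ₜ Circle} (h : XSpec n i f)
    (hi : i < (n - 1) * k) : Good f (vs n k i) (VV n (k + 1)) := by
  have hm : (n - 1) * (k + 1) = (n - 1) * k + (n - 1) := Nat.mul_succ _ _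
  have hp := part_v hn hi
  apply good_of_forward (wf_sp hn (wf_vine hn k) hp) (wf_vine hn _)
  intro a b hab
  rcases (parts_sp hn (wf_vine hn k) hp).1 hab with ⟨h1, h2⟩ | ⟨j, hj, rfl, rfl⟩
  · rcases (parts_vine hn).1 h1 with ⟨l, hl, rfl, rfl⟩ | ⟨rfl, rfl⟩
    · rcases lt_trichotomy l i with h3 | rfl | h3
      · exact ⟨_, _, part_v hn (by omega), h.fix l h3⟩
      · exact absurd rfl h2
      · exact ⟨_, _, part_v hn (by omega), h.shift l h3⟩
    · exact ⟨_, _, (parts_vine hn).2 (Or.inr ⟨rfl, rfl⟩), h.tail k hi⟩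
  · exact ⟨_, _, part_v hn (by omega), h.kid j hj⟩

lemma XSpec.conj {n i : ℕ} (hn : 2 ≤ n) {f x : Circle ≃ₜ Circle} (hx : XSpec n 0 x)
    (h : XSpec n i f) (hi : 1 ≤ i) : XSpec n (i + (n - 1)) (x * f * x⁻¹) := by
  have c : ∀ {a b a' b' c d c' d' : ℝ}, AffMap x a b a' b' → AffMap f a b c d →
      AffMap x c d c' d' → AffMap (x * f * x⁻¹) a' b' c' d' :=
    fun h1 h2 h3 => (h3.comp h2).comp h1.inv
  constructor
  · intro l hl
    rcases Nat.lt_or_ge l n with h1 | h1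
    · have h2 := hx.kid l h1
      have h3 := (h.fix 0 hi).kid hn h1
      simp only [zero_add] at h2 h3
      exact c h2 h3 h2
    · obtain ⟨l', rfl⟩ := Nat.exists_eq_add_of_le' (show n - 1 ≤ l by omega)
      have h2 := hx.shift l' (by omega)
      exact c h2 (h.fix l' (by omega)) h2
  · intro j hj
    have h1 := (hx.shift i hi).kid hn hj
    have h2 := h.kid j hj
    have h3 := hx.shift (i + j) (by omega)
    rw [show i + (n - 1) + j = i + j + (n - 1) by ring]
    exact c h1 h2 h3
  · intro l hl
    obtain ⟨l', rfl⟩ := Nat.exists_eq_add_of_le' (show n - 1 ≤ l by omega)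
    exact c (hx.shift l' (by omega)) (h.shift l' (by omega)) (hx.shift _ (by omega))
  · intro k hk
    rcases k with _ | k
    · simp at hk
    · have hm : (n - 1) * (k + 1) = (n - 1) * k + (n - 1) := Nat.mul_succ _ _
      have hm' : (n - 1) * (k + 1 + 1) = (n - 1) * (k + 1) + (n - 1) := Nat.mul_succ _ _
      exact c (hx.tail k (by omega)) (h.tail k (by omega)) (hx.tail (k + 1) (by omega))

lemma XSpec.ne {n i j : ℕ} (hn : 2 ≤ n) {f : Circle ≃ₜ Circle} (h : XSpec n i f)
    (h' : XSpec n j f) (hij : i < j) : False := by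
  have h1 := (h.kid (n - 1) (by omega)).right
  rw [show n - 1 + 1 = n by omega, kd_n hn] at h1
  have h2 := (h'.fix i hij).right
  rw [h2] at h1
  have := coe_inj (vn_nonneg hn _) (vn_lt_one hn _) (vn_nonneg hn _) (vn_lt_one hn _) h1
  have := (vn_strictMono hn).injective this
  omega

lemma mk_homeo {G H : ℝ → ℝ} (hG : Continuous G) (hH : Continuous H)
    (h1 : ∀ x, G (x + 1) = G x + 1) (h2 : ∀ x, H (x + 1) = H x + 1)
    (hGH : ∀ x, G (H x) = x) (hHG : ∀ x, H (G x) = x) :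
    ∃ f : Circle ≃ₜ Circle, IsLift f G := by
  have p : ∀ {K : ℝ → ℝ}, (∀ x, K (x + 1) = K x + 1) →
      Function.Periodic (fun x => ((K x : ℝ) : Circle)) 1 := by
    intro K hK x
    simp only [hK]
    exact coe_eq.2 ⟨1, by simp⟩
  have q : ∀ {K : ℝ → ℝ} (hK : ∀ x, K (x + 1) = K x + 1), Continuous K →
      Continuous (p hK).lift := by
    intro K hK hc
    apply continuous_coinduced_dom.2
    exact (AddCircle.continuous_mk' (1:ℝ)).comp hc
  refine ⟨⟨⟨(p h1).lift, (p h2).lift, ?_, ?_⟩, q h1 hG, q h2 hH⟩, ?_⟩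
  · intro x
    obtain ⟨y, -, -, rfl⟩ := coe_surj x
    rw [Function.Periodic.lift_coe, Function.Periodic.lift_coe, hHG]
  · intro x
    obtain ⟨y, -, -, rfl⟩ := coe_surj x
    rw [Function.Periodic.lift_coe, Function.Periodic.lift_coe, hGH]
  · intro x
    exact Function.Periodic.lift_coe (p h1) x

lemma mk_homeo2 {F : ℝ → ℝ} (hF : StrictMono F) (hc : Continuous F) (h0 : F 0 = 0) (h1 : F 1 = 1) :
    ∃ (f : Circle ≃ₜ Circle) (G : ℝ → ℝ), StrictMono G ∧ IsLift f G ∧ (∀ x, G (x + 1) = G x + 1) ∧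
      ∀ x, 0 ≤ x → x ≤ 1 → G x = F x := by
  let G : ℝ → ℝ := fun x => ⌊x⌋ + F (Int.fract x)
  have G1 : ∀ x, G (x + 1) = G x + 1 := by
    intro x; simp only [G, Int.floor_add_one, Int.fract_add_one]; push_cast; ring
  have F0 : ∀ x, 0 ≤ F (Int.fract x) := fun x => by
    rw [← h0]; exact hF.monotone (Int.fract_nonneg x)
  have F1 : ∀ x, F (Int.fract x) < 1 := fun x => by
    rw [← h1]; exact hF (Int.fract_lt_one x)
  have Gm : StrictMono G := by
    intro x y hxy
    simp only [G]
    rcases lt_or_eq_of_le (Int.floor_mono hxy.le) with h | h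
    · have : (⌊x⌋ : ℝ) + 1 ≤ ⌊y⌋ := by exact_mod_cast h
      have := F0 y; have := F1 x
      linarith
    · rw [h]
      have : Int.fract x < Int.fract y := by
        have a := Int.floor_add_fract x
        have b := Int.floor_add_fract y
        rw [h] at a; linarith
      have := hF this
      linarith
  have GF : ∀ x, 0 ≤ x → x ≤ 1 → G x = F x := by
    intro x hx hx1
    rcases lt_or_eq_of_le hx1 with h | rfl
    · simp only [G]
      rw [Int.floor_eq_zero_iff.2 ⟨hx, h⟩, Int.fract_eq_self.2 ⟨hx, h⟩]; simp
    · simp [G, h0, h1]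
  have Gs : Function.Surjective G := by
    intro y
    obtain ⟨x, ⟨hx0, hx1⟩, hx⟩ := intermediate_value_Icc (zero_le_one' ℝ) hc.continuousOn
      (show Int.fract y ∈ Set.Icc (F 0) (F 1) by
        rw [h0, h1]; exact ⟨Int.fract_nonneg y, (Int.fract_lt_one y).le⟩)
    have : ∀ z : ℤ, G (x + z) = G x + z := by
      intro z; simp only [G, Int.floor_add_intCast, Int.fract_add_intCast]; push_cast; ring
    refine ⟨x + ⌊y⌋, ?_⟩
    rw [this, GF x hx0 hx1, hx, Int.fract_add_floor]
  let e := (StrictMono.orderIsoOfSurjective G Gm Gs)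
  have he : ∀ x, e x = G x := fun x => rfl
  have hs : ∀ x, G (e.symm x) = x := fun x => by rw [← he]; simp
  have hs' : ∀ x, e.symm (G x) = x := fun x => by rw [← he]; simp
  obtain ⟨f, hf⟩ := mk_homeo (G := G) (H := e.symm) e.continuous e.symm.continuous G1
    (by
      intro x
      apply Gm.injective
      rw [hs, G1, hs]) hs hs'
  exact ⟨f, G, Gm, hf, G1, GF⟩

lemma IsNAdic.add {n : ℕ} (hn : 2 ≤ n) {x y : ℝ} (hx : IsNAdic n x) (hy : IsNAdic n y) :
    IsNAdic n (x + y) := by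
  have hn0 : (n : ℝ) ≠ 0 := by positivity
  obtain ⟨a, k, rfl⟩ := hx
  obtain ⟨b, l, rfl⟩ := hy
  refine ⟨a * n ^ l + b * n ^ k, k + l, ?_⟩
  push_cast; field_simp; ring

lemma IsNAdic.neg {n : ℕ} {x : ℝ} (hx : IsNAdic n x) : IsNAdic n (-x) := by
  obtain ⟨a, k, rfl⟩ := hx
  exact ⟨-a, k, by push_cast; ring⟩

lemma IsNAdic.sub {n : ℕ} (hn : 2 ≤ n) {x y : ℝ} (hx : IsNAdic n x) (hy : IsNAdic n y) :
    IsNAdic n (x - y) := by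
  rw [sub_eq_add_neg]; exact hx.add hn hy.neg

lemma IsNAdic.int {n : ℕ} (z : ℤ) : IsNAdic n z := ⟨z, 0, by simp⟩

lemma IsNAdic.zero {n : ℕ} : IsNAdic n 0 := by simpa using IsNAdic.int (n := n) 0
lemma IsNAdic.one {n : ℕ} : IsNAdic n 1 := by simpa using IsNAdic.int (n := n) 1

lemma IsNAdic.zpow_mul {n : ℕ} (hn : 2 ≤ n) {x : ℝ} (hx : IsNAdic n x) (s : ℤ) :
    IsNAdic n ((n : ℝ) ^ s * x) := by
  have hn0 : (n : ℝ) ≠ 0 := by positivity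
  obtain ⟨a, k, rfl⟩ := hx
  obtain ⟨m, rfl | rfl⟩ := Int.eq_nat_or_neg s
  · refine ⟨a * n ^ m, k, ?_⟩
    push_cast; rw [zpow_natCast]; ring
  · refine ⟨a, k + m, ?_⟩
    rw [zpow_neg, zpow_natCast, pow_add]; field_simp

lemma IsNAdic.nat_mul {n : ℕ} {x : ℝ} (hx : IsNAdic n x) (m : ℕ) :
    IsNAdic n (m * x) := by
  obtain ⟨a, k, rfl⟩ := hx
  exact ⟨m * a, k, by push_cast; ring⟩

lemma IsNAdic.div {n : ℕ} (hn : 2 ≤ n) {x : ℝ} (hx : IsNAdic n x) : IsNAdic n (x / n) := by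
  have := hx.zpow_mul hn (-1)
  rwa [zpow_neg_one, inv_mul_eq_div] at this

lemma isNAdic_line {n : ℕ} (hn : 2 ≤ n) {x c : ℝ} {s : ℤ} (hc : IsNAdic n c) :
    IsNAdic n ((n : ℝ) ^ s * x + c) ↔ IsNAdic n x := by
  have hn0 : (n : ℝ) ≠ 0 := by positivity
  constructor
  · intro h
    have := (h.sub hn hc).zpow_mul hn (-s)
    rwa [add_sub_cancel_right, ← mul_assoc, ← zpow_add₀ hn0, neg_add_cancel, zpow_zero, one_mul] at this
  · intro h
    exact (h.zpow_mul hn s).add hn hc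

lemma exists_piece {t : ℕ → ℝ} {m : ℕ} {x : ℝ} (hm : 0 < m) (h0 : t 0 ≤ x) (h1 : x ≤ t m) :
    ∃ i < m, x ∈ Set.Icc (t i) (t (i + 1)) := by
  induction m with
  | zero => omega
  | succ m ih =>
    rcases le_total (t m) x with h | h
    · exact ⟨m, by omega, h, h1⟩
    · rcases Nat.eq_zero_or_pos m with rfl | hm'
      · exact ⟨0, by omega, h0, h1⟩
      · obtain ⟨i, hi, h⟩ := ih hm' h
        exact ⟨i, by omega, h⟩

lemma image_nadic {n : ℕ} (hn : 2 ≤ n) {f : Circle ≃ₜ Circle} {F : ℝ → ℝ}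
    (hf : ∀ x : ℝ, 0 ≤ x → x < 1 → f x = ((F x : ℝ) : Circle))
    (h : ∀ x, 0 ≤ x → x < 1 → (IsNAdic n (F x) ↔ IsNAdic n x)) :
    f '' nAdicPoints n = nAdicPoints n := by
  ext p
  constructor
  · rintro ⟨_, ⟨x, hx, rfl⟩, rfl⟩
    obtain ⟨y, hy0, hy1, hy⟩ := coe_surj (x : Circle)
    refine ⟨F y, (h y hy0 hy1).2 ?_, ?_⟩
    · obtain ⟨z, rfl⟩ := coe_eq.1 hy
      exact hx.add hn (IsNAdic.int z)
    · rw [← hy, hf y hy0 hy1]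
  · rintro ⟨x, hx, rfl⟩
    obtain ⟨y, hy0, hy1, hy⟩ := coe_surj (f.symm (x : Circle))
    refine ⟨y, ⟨y, (h y hy0 hy1).1 ?_, rfl⟩, ?_⟩
    · have : f y = x := by rw [hy]; simp
      rw [hf y hy0 hy1] at this
      obtain ⟨z, hz⟩ := coe_eq.1 this
      rw [hz]; exact hx.add hn (IsNAdic.int z)
    · rw [hy]; simp

lemma mk_inT {n : ℕ} (hn : 2 ≤ n) {F : ℝ → ℝ} (hF : StrictMono F) (hc : Continuous F)
    (h0 : F 0 = 0) (h1 : F 1 = 1) (m : ℕ) (t : ℕ → ℝ) (s : ℕ → ℤ) (c : ℕ → ℝ)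
    (hm : 0 < m) (t0 : t 0 = 0) (tm : t m = 1) (ht : ∀ i, i < m → t i < t (i + 1))
    (hta : ∀ i, i ≤ m → IsNAdic n (t i)) (hca : ∀ i, i < m → IsNAdic n (c i))
    (hp : ∀ i, i < m → ∀ x ∈ Set.Icc (t i) (t (i + 1)), F x = (n : ℝ) ^ (s i) * x + c i) :
    ∃ f, InT n f ∧ ∀ x : ℝ, 0 ≤ x → x ≤ 1 → f x = ((F x : ℝ) : Circle) := by
  obtain ⟨f, G, Gm, hf, G1, GF⟩ := mk_homeo2 hF hc h0 h1
  have hfF : ∀ x : ℝ, 0 ≤ x → x ≤ 1 → f x = ((F x : ℝ) : Circle) := by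
    intro x hx hx1; rw [hf, GF x hx hx1]
  have mono : ∀ i j, i ≤ j → j ≤ m → t i ≤ t j := by
    intro i j hij
    induction j, hij using Nat.le_induction with
    | base => simp
    | succ j hj ih => intro h; exact (ih (by omega)).trans (ht j (by omega)).le
  refine ⟨f, ⟨?_, G, Gm, hf, G1, m, t, s, c, hm, t0, tm, ht, hta, ?_⟩, hfF⟩
  · apply image_nadic hn (fun x hx hx1 => hfF x hx hx1.le)
    intro x hx hx1
    obtain ⟨i, hi, hxi⟩ := exists_piece (t := t) (x := x) hm (by rw [t0]; exact hx) (by rw [tm]; exact hx1.le)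
    rw [hp i hi x hxi]
    exact isNAdic_line hn (hca i hi)
  · intro i hi x hx
    rw [GF x, hp i hi x hx]
    · have := mono 0 i (by omega) (by omega); rw [t0] at this; exact this.trans hx.1
    · have := mono (i+1) m (by omega) (by omega); rw [tm] at this; exact hx.2.trans this

def FF (N v δ m x : ℝ) : ℝ :=
  max x (min (v + N * (x - v)) (min (x + (m * δ - m * δ / N)) (1 - (1 - x) / N)))

section
variable {N v δ m : ℝ} (hN : 2 ≤ N) (hv : 0 ≤ v) (hδ : 0 < δ) (hm : 1 ≤ m) (hmN : m ≤ N - 1)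
  (hs : v + (m + 1) * δ = 1)
include hN
lemma FF_mono : StrictMono (FF N v δ m) := by
  have : 0 < N := by linarith
  intro x y h
  unfold FF
  have h3 := (div_lt_div_iff_of_pos_right this).2 (show 1 - y < 1 - x by linarith)
  have h4 : N * (x - v) < N * (y - v) := by nlinarith
  exact max_lt_max h (min_lt_min (by linarith) (min_lt_min (by linarith) (by linarith)))
omit hN in
lemma FF_cont : Continuous (FF N v δ m) := by
  unfold FF
  fun_prop

lemma FF0 {x : ℝ} (hx : x ≤ v) : FF N v δ m x = x := by
  unfold FF
  apply max_eq_left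
  refine (min_le_left _ _).trans ?_
  nlinarith

include hδ hm hmN hs
lemma FF_ge {x : ℝ} (h1 : v ≤ x) (h2 : x ≤ 1) : FF N v δ m x =
    min (v + N * (x - v)) (min (x + (m * δ - m * δ / N)) (1 - (1 - x) / N)) := by
  have hN0 : 0 < N := by linarith
  unfold FF
  apply max_eq_right
  refine le_min (by nlinarith) (le_min ?_ ?_)
  · have : m * δ / N ≤ m * δ := div_le_self (by positivity) (by linarith)
    linarith
  · have : (1 - x) / N ≤ 1 - x := div_le_self (by linarith) (by linarith)
    linarith

lemma FF1 {x : ℝ} (h1 : v ≤ x) (h2 : x ≤ v + m * δ / N) : FF N v δ m x = v + N * (x - v) := by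
  have hN0 : 0 < N := by linarith
  have e : m * δ / N * N = m * δ := div_mul_cancel₀ _ hN0.ne'
  have hA : m * δ / N ≤ δ := by rw [div_le_iff₀ hN0]; nlinarith
  have hl : v + N * (x - v) ≤ x + (m * δ - m * δ / N) := by nlinarith
  rw [FF_ge hN hδ hm hmN hs h1 (by nlinarith)]
  refine min_eq_left (le_min hl (hl.trans ?_))
  have : (1 - x) / N * N = 1 - x := div_mul_cancel₀ _ hN0.ne'
  nlinarith

lemma FF2 {x : ℝ} (h1 : v + m * δ / N ≤ x) (h2 : x ≤ v + δ) :
    FF N v δ m x = x + (m * δ - m * δ / N) := by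
  have hN0 : 0 < N := by linarith
  have e : m * δ / N * N = m * δ := div_mul_cancel₀ _ hN0.ne'
  have e2 : (1 - x) / N * N = 1 - x := div_mul_cancel₀ _ hN0.ne'
  have hA : 0 ≤ m * δ / N := by positivity
  rw [FF_ge hN hδ hm hmN hs (by linarith) (by nlinarith)]
  have : x + (m * δ - m * δ / N) ≤ 1 - (1 - x) / N := by nlinarith
  rw [min_eq_left this, min_eq_right]
  nlinarith

lemma FF3 {x : ℝ} (h1 : v + δ ≤ x) (h2 : x ≤ 1) :
    FF N v δ m x = 1 - (1 - x) / N := by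
  have hN0 : 0 < N := by linarith
  have e : m * δ / N * N = m * δ := div_mul_cancel₀ _ hN0.ne'
  have e2 : (1 - x) / N * N = 1 - x := div_mul_cancel₀ _ hN0.ne'
  have hA : m * δ / N ≤ δ := by rw [div_le_iff₀ hN0]; nlinarith
  rw [FF_ge hN hδ hm hmN hs (by linarith) h2]
  have : 1 - (1 - x) / N ≤ x + (m * δ - m * δ / N) := by nlinarith
  rw [min_eq_right this, min_eq_right]
  nlinarith
end

lemma affMap_of {f : Circle ≃ₜ Circle} {F : ℝ → ℝ} (hf : ∀ x : ℝ, 0 ≤ x → x ≤ 1 → f x = ((F x : ℝ) : Circle))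
    {a b a' b' s c : ℝ} (h0 : 0 ≤ a) (hab : a ≤ b) (h1 : b ≤ 1)
    (hF : ∀ x, a ≤ x → x ≤ b → F x = s * x + c) (ha : s * a + c = a') (hb : s * b + c = b') :
    AffMap f a b a' b' := by
  intro t ht ht1
  have h2 : a ≤ a + t * (b - a) := by nlinarith
  have h3 : a + t * (b - a) ≤ b := by nlinarith
  rw [hf _ (by linarith) (by linarith), hF _ h2 h3, ← ha, ← hb]
  congr 1
  ring

lemma vn_nadic {n : ℕ} (hn : 2 ≤ n) (i : ℕ) : IsNAdic n (vn n i) := by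
  induction i with
  | zero => exact IsNAdic.zero
  | succ i ih => rw [vn_succ]; exact ih.add hn ⟨1, i / (n - 1) + 1, by simp⟩

lemma exists_X {n : ℕ} (hn : 2 ≤ n) (i : ℕ) : ∃ f, InT n f ∧ XSpec n i f := by
  have hN : (2 : ℝ) ≤ n := by exact_mod_cast hn
  have hN0 : (0 : ℝ) < n := by linarith
  obtain ⟨w, e, he, rfl⟩ : ∃ w e, e < n - 1 ∧ i = (n - 1) * w + e :=
    ⟨i / (n - 1), i % (n - 1), Nat.mod_lt _ (by omega), (Nat.div_add_mod _ _).symm⟩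
  set i := (n - 1) * w + e with hi
  obtain ⟨M, hM⟩ : ∃ M, M + e = n - 1 := ⟨n - 1 - e, by omega⟩
  set v := vn n i with hv
  set δ := 1 / (n : ℝ) ^ (w + 1) with hδ
  have hv0 : 0 ≤ v := vn_nonneg hn i
  have hδ0 : 0 < δ := by positivity
  set m : ℝ := (M : ℝ) with hm
  have hM1 : 1 ≤ M := by omega
  have hm1 : 1 ≤ m := by rw [hm]; exact_mod_cast hM1
  have hMe : m + e = n - 1 := by
    have : ((M + e : ℕ) : ℝ) = ((n - 1 : ℕ) : ℝ) := by rw [hM]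
    rw [Nat.cast_sub (by omega)] at this
    push_cast at this
    exact this
  have hmN : m ≤ n - 1 := by
    have : (0 : ℝ) ≤ e := by positivity
    linarith
  have hvadd : ∀ j ≤ M, vn n (i + j) = v + j * δ := by
    intro j hj
    rw [hv, hi, add_assoc, vn_add hn w (e + j) (by omega), vn_add hn w e (by omega)]
    rw [hδ]; push_cast; ring
  have hs : v + (m + 1) * δ = 1 := by
    have := hvadd M le_rfl
    rw [hi, add_assoc, add_comm e, hM, ← Nat.mul_succ, vn_mul hn] at this
    rw [Nat.succ_eq_add_one, ← hδ, ← hm] at this; linarith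
  have hvadd2 : ∀ j, M ≤ j → j ≤ n → vn n (i + j) = v + m * δ + (j - m) * (δ / n) := by
    intro j hj hjn
    have h1 : i + j = (n - 1) * (w + 1) + (j - M) := by
      rw [Nat.mul_succ]; omega
    rw [h1, vn_add hn _ _ (by omega), vn_mul hn, Nat.cast_sub hj]
    have : 1 - δ = v + m * δ := by linarith
    rw [← this, hδ, pow_succ _ (w + 1)]
    field_simp
    rw [hm]
  have hv1 : vn n (i + 1) = v + δ := by rw [hvadd 1 hM1]; simp
  have hkd : ∀ j, kd n v (vn n (i + 1)) j = v + j * δ / n := by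
    intro j; rw [hv1, kd]; ring
  have hmδ : m * δ / n < δ := by rw [div_lt_iff₀ hN0]; nlinarith
  have hmδ0 : 0 < m * δ / n := by positivity
  have aδ : IsNAdic n δ := ⟨1, w + 1, by simp [hδ]⟩
  have av : IsNAdic n v := vn_nadic hn i
  have amδ : IsNAdic n (m * δ) := aδ.nat_mul M
  have G0 : ∀ x ≤ v, FF n v δ m x = x := fun x hx => FF0 hN hx
  have G1 : ∀ x, v ≤ x → x ≤ v + m * δ / n → FF n v δ m x = n * x + (v - n * v) :=
    fun x h1 h2 => by rw [FF1 hN hδ0 hm1 hmN hs h1 h2]; ring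
  have G2 : ∀ x, v + m * δ / n ≤ x → x ≤ v + δ → FF n v δ m x = 1 * x + (m * δ - m * δ / n) :=
    fun x h1 h2 => by rw [FF2 hN hδ0 hm1 hmN hs h1 h2]; ring
  have G3 : ∀ x, v + δ ≤ x → x ≤ 1 → FF n v δ m x = (n : ℝ)⁻¹ * x + (1 - 1 / n) :=
    fun x h1 h2 => by rw [FF3 hN hδ0 hm1 hmN hs h1 h2]; ring
  have a1 : IsNAdic n (v - n * v) := av.sub hn (av.nat_mul n)
  have a2 : IsNAdic n (m * δ - m * δ / n) := amδ.sub hn (amδ.div hn)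
  have a3 : IsNAdic n (1 - 1 / (n : ℝ)) := IsNAdic.one.sub hn (IsNAdic.one.div hn)
  have hvδ : v + δ < 1 := by nlinarith
  obtain ⟨f, hf, hfF⟩ : ∃ f, InT n f ∧
      ∀ x : ℝ, 0 ≤ x → x ≤ 1 → f x = ((FF n v δ m x : ℝ) : Circle) := by
    have F0 : FF n v δ m 0 = 0 := G0 0 hv0
    have F1 : FF n v δ m 1 = 1 := by rw [G3 1 hvδ.le le_rfl]; field_simp; ring
    rcases lt_or_eq_of_le hv0 with h | h
    · refine mk_inT hn (FF_mono hN) FF_cont F0 F1 4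
        (fun j => match j with | 0 => 0 | 1 => v | 2 => v + m * δ / n | 3 => v + δ | _ => 1)
        (fun j => match j with | 0 => 0 | 1 => 1 | 2 => 0 | _ => -1)
        (fun j => match j with | 0 => 0 | 1 => v - n * v | 2 => m * δ - m * δ / n | _ => 1 - 1 / n)
        (by norm_num) rfl rfl ?_ ?_ ?_ ?_
      · intro j hj
        interval_cases j
        · exact h
        · show v < v + m * δ / n
          linarith
        · show v + m * δ / n < v + δ
          linarith
        · exact hvδ
      · intro j hj
        interval_cases j
        · exact IsNAdic.zero
        · exact av
        · exact av.add hn (amδ.div hn)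
        · exact av.add hn aδ
        · exact IsNAdic.one
      · intro j hj
        interval_cases j
        · exact IsNAdic.zero
        · exact a1
        · exact a2
        · exact a3
      · intro j hj x hx
        interval_cases j
        · have h1 := hx.1; have h2 := hx.2
          simp only [zero_add] at h1 h2
          simp only [zpow_zero]
          rw [G0 x h2]; ring
        · simp only [zpow_one]; exact G1 x hx.1 hx.2
        · simp only [zpow_zero]; exact G2 x hx.1 hx.2
        · simp only [zpow_neg_one]; exact G3 x hx.1 hx.2
    · refine mk_inT hn (FF_mono hN) FF_cont F0 F1 3
        (fun j => match j with | 0 => v | 1 => v + m * δ / n | 2 => v + δ | _ => 1)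
        (fun j => match j with | 0 => 1 | 1 => 0 | _ => -1)
        (fun j => match j with | 0 => v - n * v | 1 => m * δ - m * δ / n | _ => 1 - 1 / n)
        (by norm_num) h.symm rfl ?_ ?_ ?_ ?_
      · intro j hj
        interval_cases j
        · show v < v + m * δ / n
          linarith
        · show v + m * δ / n < v + δ
          linarith
        · exact hvδ
      · intro j hj
        interval_cases j
        · exact av
        · exact av.add hn (amδ.div hn)
        · exact av.add hn aδ
        · exact IsNAdic.one
      · intro j hj
        interval_cases j
        · exact a1
        · exact a2
        · exact a3
      · intro j hj x hx
        interval_cases j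
        · simp only [zpow_one]; exact G1 x hx.1 hx.2
        · simp only [zpow_zero]; exact G2 x hx.1 hx.2
        · simp only [zpow_neg_one]; exact G3 x hx.1 hx.2
  have mono := (vn_strictMono hn).monotone
  have mle : ∀ l, vn n l ≤ vn n (l + 1) := fun l => mono (by omega)
  refine ⟨f, hf, ?_, ?_, ?_, ?_⟩
  · intro l hl
    refine affMap_of hfF (s := 1) (c := 0) (vn_nonneg hn _) (mle l) (vn_lt_one hn _).le ?_ (by ring) (by ring)
    intro x hx hx1
    have : vn n (l + 1) ≤ v := mono (by omega)
    rw [G0 x (by linarith)]; ring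
  · intro j hj
    rw [hkd, hkd]
    have hd : δ / n > 0 := by positivity
    have hj0 : (0 : ℝ) ≤ j := by positivity
    have hjn : (j : ℝ) + 1 ≤ n := by exact_mod_cast hj
    have q1 : (j : ℝ) * δ / n = j * (δ / n) := by ring
    have q2 : ((j + 1 : ℕ) : ℝ) * δ / n = j * (δ / n) + δ / n := by push_cast; ring
    have q3 : m * δ / n = m * (δ / n) := by ring
    have q4 : δ = n * (δ / n) := by field_simp
    have hle : v + j * δ / n ≤ v + (j + 1 : ℕ) * δ / n := by rw [q1, q2]; linarith
    have hle1 : v + (j + 1 : ℕ) * δ / n ≤ v + δ := by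
      rw [q2]; nlinarith
    have h0le : 0 ≤ v + j * δ / n := by positivity
    rcases Nat.lt_or_ge j M with h | h
    · refine affMap_of hfF (s := n) (c := v - n * v) h0le hle (by linarith) ?_ ?_ ?_
      · intro x hx hx1
        apply G1 x
        · have : 0 ≤ j * δ / n := by positivity
          linarith
        · refine hx1.trans ?_
          have : (j : ℝ) + 1 ≤ m := by rw [hm]; exact_mod_cast h
          rw [q2, q3]; nlinarith
      · rw [hvadd j (by omega)]; field_simp; ring
      · rw [add_assoc, hvadd (j + 1) (by omega)]; field_simp; ring
    · have hmj : m ≤ j := by rw [hm]; exact_mod_cast h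
      refine affMap_of hfF (s := 1) (c := m * δ - m * δ / n) h0le hle (by linarith) ?_ ?_ ?_
      · intro x hx hx1
        apply G2 x
        · refine le_trans ?_ hx
          rw [q1, q3]; nlinarith
        · linarith
      · rw [hvadd2 j (by omega) (by omega)]; ring
      · rw [add_assoc, hvadd2 (j + 1) (by omega) (by omega)]; ring
  · intro l hl
    have : v + δ ≤ vn n l := by rw [← hv1]; exact mono (by omega)
    refine affMap_of hfF (s := (n : ℝ)⁻¹) (c := 1 - 1 / n) (vn_nonneg hn _) (mle l) (vn_lt_one hn _).le ?_ ?_ ?_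
    · intro x hx hx1
      exact G3 x (by linarith) (by linarith [vn_lt_one hn (l + 1)])
    · rw [vn_shift hn]; ring
    · rw [show l + (n - 1) + 1 = l + 1 + (n - 1) by ring, vn_shift hn]; ring
  · intro k hk
    have : v + δ ≤ vn n ((n - 1) * k) := by rw [← hv1]; exact mono (by omega)
    refine affMap_of hfF (s := (n : ℝ)⁻¹) (c := 1 - 1 / n) (vn_nonneg hn _) (vn_lt_one hn _).le le_rfl ?_ ?_ ?_
    · intro x hx hx1
      exact G3 x (by linarith) (by linarith)
    · rw [Nat.mul_succ, vn_shift hn]; ring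
    · field_simp; ring

lemma exists_rot {n : ℕ} (hn : 2 ≤ n) : ∃ f, InT n f ∧ Good f (VV n 1) (VV n 1) ∧
    ∀ x : ℝ, f x = ((x + 1 / n : ℝ) : Circle) := by
  have hN : (2 : ℝ) ≤ n := by exact_mod_cast hn
  have hN0 : (0 : ℝ) < n := by linarith
  have ha : IsNAdic n (1 / (n : ℝ)) := ⟨1, 1, by simp⟩
  obtain ⟨f, hf⟩ := mk_homeo (G := fun x => x + 1 / n) (H := fun x => x - 1 / n) (by fun_prop)
    (by fun_prop) (fun x => by ring) (fun x => by ring) (fun x => by ring) (fun x => by ring)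
  have hf' : ∀ x : ℝ, f x = ((x + 1 / n : ℝ) : Circle) := hf
  have hl : ∀ x : ℝ, x + 1 / n = (n : ℝ) ^ (0 : ℤ) * x + 1 / n := fun x => by simp
  refine ⟨f, ⟨image_nadic hn (fun x _ _ => hf x) (fun x _ _ => ?_), _, ?_, hf, fun x => by ring, 1,
    fun j => j, fun _ => 0, fun _ => 1 / n, by norm_num, by simp, by simp, fun i _ => by simp,
    fun i _ => by simpa using IsNAdic.int (n := n) i, fun i _ x _ => hl x⟩, ?_, hf'⟩
  · show IsNAdic n (x + 1 / n) ↔ _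
    rw [hl, isNAdic_line hn ha]
  · intro x y h; dsimp only; linarith
  · have hv : ∀ j ≤ n - 1, vn n j = j / n := by
      intro j hj
      have := vn_add hn 0 j hj
      simpa [vn_zero] using this
    have hp : ∀ j < n, Parts (VV n 1) (j / n) ((j + 1) / n) := by
      intro j hj
      rw [parts_vine hn]
      rcases Nat.lt_or_ge j (n - 1) with h | h
      · left
        exact ⟨j, by omega, (hv j (by omega)).symm, by rw [hv (j + 1) (by omega)]; push_cast; rfl⟩
      · right
        have : j = n - 1 := by omega
        subst this
        constructor
        · rw [mul_one, hv _ le_rfl]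
        · rw [Nat.cast_sub (by omega)]; field_simp; push_cast; ring
    apply good_of_forward (wf_vine hn 1) (wf_vine hn 1)
    intro a b hab
    obtain ⟨j, hj, rfl, rfl⟩ : ∃ j < n, a = j / n ∧ b = (j + 1) / n := by
      rcases (parts_vine hn).1 hab with ⟨i, hi, rfl, rfl⟩ | ⟨rfl, rfl⟩
      · refine ⟨i, by omega, hv i (by omega), ?_⟩
        rw [hv (i + 1) (by omega)]; push_cast; rfl
      · refine ⟨n - 1, by omega, ?_, ?_⟩
        · rw [mul_one, hv _ le_rfl]
        · rw [Nat.cast_sub (by omega)]; field_simp; push_cast; ring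
    rcases Nat.lt_or_ge (j + 1) n with h | h
    · refine ⟨_, _, hp (j + 1) h, ?_⟩
      intro t ht ht1
      rw [hf']; congr 1; push_cast; ring
    · refine ⟨_, _, hp 0 (by omega), ?_⟩
      intro t ht ht1
      rw [hf', coe_eq]
      refine ⟨1, ?_⟩
      have : n = j + 1 := by omega
      have : (n : ℝ) = j + 1 := by exact_mod_cast this
      field_simp; push_cast; rw [this]; ring

def Lv (n l : ℕ) (a b : ℝ) : Prop := ∃ A : ℕ, A < n ^ l ∧ a = A / (n : ℝ) ^ l ∧ b = (A + 1) / (n : ℝ) ^ l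

lemma Lv.kid {n l : ℕ} (hn : 2 ≤ n) {a b : ℝ} (h : Lv n l a b) {j : ℕ} (hj : j < n) :
    Lv n (l + 1) (kd n a b j) (kd n a b (j + 1)) := by
  have hn0 : (n : ℝ) ≠ 0 := by positivity
  obtain ⟨A, hA, rfl, rfl⟩ := h
  refine ⟨A * n + j, ?_, ?_, ?_⟩
  · rw [pow_succ]; nlinarith
  · rw [kd]; push_cast; field_simp; ring
  · rw [kd]; push_cast; field_simp; ring

lemma Lv.bd {n l : ℕ} (hn : 2 ≤ n) {a b : ℝ} (h : Lv n l a b) : 0 ≤ a ∧ a < b ∧ b ≤ 1 := by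
  have hn0 : (0 : ℝ) < n := by positivity
  obtain ⟨A, hA, rfl, rfl⟩ := h
  refine ⟨by positivity, ?_, ?_⟩
  · apply div_lt_div_of_pos_right _ (by positivity); linarith
  · rw [div_le_one (by positivity)]; exact_mod_cast hA

/-- every part of `P` is mapped by `f` onto an interval of level at most `L` -/
def LvLe (n L : ℕ) (f : Circle ≃ₜ Circle) (P : Finset ℝ) : Prop :=
  ∀ a b, Parts P a b → ∃ l ≤ L, ∃ c d, Lv n l c d ∧ AffMap f a b c d

lemma card_le_of {n L : ℕ} (hn : 2 ≤ n) {f : Circle ≃ₜ Circle} {P : Finset ℝ} (hP : Wf P)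
    (h : LvLe n L f P) : P.card ≤ n ^ L := by
  have hn0 : (n : ℝ) ≠ 0 := by positivity
  have : ∀ a ∈ P, ∃ B, B < n ^ L ∧ f a = ((B / (n : ℝ) ^ L : ℝ) : Circle) := by
    intro a ha
    obtain ⟨b, hb⟩ := exists_next hP ha
    obtain ⟨l, hl, c, d, ⟨A, hA, rfl, rfl⟩, hf⟩ := h a b hb
    obtain ⟨e, rfl⟩ := Nat.exists_eq_add_of_le hl
    refine ⟨A * n ^ e, ?_, ?_⟩
    · rw [pow_add]; exact Nat.mul_lt_mul_of_pos_right hA (by positivity)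
    · rw [hf.left]; congr 1; push_cast; rw [pow_add]; field_simp
  choose! g hg hg' using this
  rw [← Finset.card_range (n ^ L)]
  apply Finset.card_le_card_of_injOn g
  · intro a ha; simpa using hg a ha
  · intro a ha b hb hab
    have h1 := hg' a ha
    rw [hab, ← hg' b hb] at h1
    exact coe_inj (hP.2 a ha).1 (hP.2 a ha).2 (hP.2 b hb).1 (hP.2 b hb).2 (f.injective h1)

lemma refine_to {n L : ℕ} (hn : 2 ≤ n) {f : Circle ≃ₜ Circle} : ∀ (m k : ℕ) (P : Finset ℝ),
    n ^ L ≤ P.card + m → IsStdSubdiv n k P → LvLe n L f P →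
    ∃ k' P', IsStdSubdiv n k' P' ∧ ∀ a b, Parts P' a b → ∃ c d, Lv n L c d ∧ AffMap f a b c d := by
  intro m
  induction m with
  | zero =>
    intro k P hm hP h
    by_cases hall : ∀ a b, Parts P a b → ∃ c d, Lv n L c d ∧ AffMap f a b c d
    · exact ⟨k, P, hP, hall⟩
    exfalso
    push Not at hall
    obtain ⟨a, b, hab, hne⟩ := hall
    obtain ⟨l, hl, c, d, hlv, hf⟩ := h a b hab
    have hlt : l < L := by
      rcases lt_or_eq_of_le hl with h | rfl
      · exact h
      · exact absurd hf (hne c d hlv)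
    have hw := wf_std hn hP
    have h2 : LvLe n L f (sp n P a b) := by
      intro a' b' h'
      rcases (parts_sp hn hw hab).1 h' with ⟨h1, -⟩ | ⟨j, hj, rfl, rfl⟩
      · exact h a' b' h1
      · exact ⟨l + 1, hlt, _, _, hlv.kid hn hj, hf.kid hn hj⟩
    have h3 := card_le_of hn (wf_sp hn hw hab) h2
    have h4 := card_std hn hP
    have h5 := card_std hn (std_of_steps (Steps.single (⟨a, b, hab, rfl⟩ : Step n P _)) hP)
    rw [add_mul, one_mul] at h5
    omega
  | succ m ih =>
    intro k P hm hP h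
    by_cases hall : ∀ a b, Parts P a b → ∃ c d, Lv n L c d ∧ AffMap f a b c d
    · exact ⟨k, P, hP, hall⟩
    push Not at hall
    obtain ⟨a, b, hab, hne⟩ := hall
    obtain ⟨l, hl, c, d, hlv, hf⟩ := h a b hab
    have hlt : l < L := by
      rcases lt_or_eq_of_le hl with h | rfl
      · exact h
      · exact absurd hf (hne c d hlv)
    have hw := wf_std hn hP
    have h2 : LvLe n L f (sp n P a b) := by
      intro a' b' h'
      rcases (parts_sp hn hw hab).1 h' with ⟨h1, -⟩ | ⟨j, hj, rfl, rfl⟩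
      · exact h a' b' h1
      · exact ⟨l + 1, hlt, _, _, hlv.kid hn hj, hf.kid hn hj⟩
    have h4 := card_std hn hP
    have h6 := std_of_steps (Steps.single (⟨a, b, hab, rfl⟩ : Step n P _)) hP
    have h5 := card_std hn h6
    rw [add_mul, one_mul] at h5
    exact ih _ _ (by omega) h6 h2

lemma uniform {n : ℕ} (hn : 2 ≤ n) (K : ℕ) : ∃ k G, IsStdSubdiv n k G ∧
    ∀ a b, Parts G a b ↔ Lv n K a b := by
  have hn0 : (0 : ℝ) < n := by positivity
  obtain ⟨k, G, hG, h⟩ := refine_to (L := K) (f := 1) hn (n ^ K) 0 {0} (by omega) IsStdSubdiv.base (by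
    intro a b hab
    have := hab
    rcases (parts_vine hn (k := 0)).1 hab with ⟨i, hi, -⟩ | ⟨h1, h2⟩
    · omega
    · refine ⟨0, by omega, a, b, ⟨0, by simp, ?_, ?_⟩, AffMap.one⟩
      · rw [h1]; simp [vn_zero]
      · rw [h2]; simp)
  have hw := wf_std hn hG
  have hf : ∀ a b, Parts G a b → Lv n K a b := by
    intro a b hab
    obtain ⟨c, d, hl, hA⟩ := h a b hab
    have b1 := hl.bd hn
    have e1 := hA.left
    have e2 := hA.right
    have b2 := hab.lt
    have b3 := hab.le_one hw
    have b4 := hab.nonneg hw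
    rw [one_app] at e1 e2
    have e3 := coe_inj b4 (by linarith) b1.1 (by linarith) e1
    subst e3
    obtain ⟨z, hz⟩ := coe_eq.1 e2
    have : z = 0 := by
      have h1 : (z : ℝ) < 1 := by linarith
      have h2 : (-1 : ℝ) < z := by linarith
      have h1 : z < 1 := by exact_mod_cast h1
      have h2 : -1 < z := by exact_mod_cast h2
      omega
    subst this
    rw [hz]; simpa using hl
  refine ⟨k, G, hG, fun a b => ⟨hf a b, fun hl => ?_⟩⟩
  have b1 := hl.bd hn
  obtain ⟨c, d, hcd, h1, h2⟩ := exists_part hw b1.1 (by linarith)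
  have hl' := hf c d hcd
  obtain ⟨A, hA, rfl, rfl⟩ := hl
  obtain ⟨C, hC, rfl, rfl⟩ := hl'
  rw [div_le_div_iff_of_pos_right (by positivity)] at h1
  rw [div_lt_div_iff_of_pos_right (by positivity)] at h2
  have h1 : C ≤ A := by exact_mod_cast h1
  have h2 : A < C + 1 := by exact_mod_cast h2
  have : A = C := by omega
  subst this
  exact hcd

lemma common_exp {n : ℕ} (hn : 2 ≤ n) {t : ℕ → ℝ} (m : ℕ) (h : ∀ i ≤ m, IsNAdic n (t i)) :
    ∃ K : ℕ, ∀ i ≤ m, ∃ a : ℤ, t i = a / (n : ℝ) ^ K := by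
  have hn0 : (n : ℝ) ≠ 0 := by positivity
  induction m with
  | zero =>
    obtain ⟨a, k, hk⟩ := h 0 le_rfl
    exact ⟨k, fun i hi => ⟨a, by rw [Nat.le_zero.1 hi]; exact hk⟩⟩
  | succ m ih =>
    obtain ⟨K, hK⟩ := ih (fun i hi => h i (by omega))
    obtain ⟨a, k, hk⟩ := h (m + 1) le_rfl
    refine ⟨K + k, fun i hi => ?_⟩
    rcases Nat.lt_or_ge i (m + 1) with h1 | h1
    · obtain ⟨b, hb⟩ := hK i (by omega)
      refine ⟨b * n ^ k, ?_⟩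
      rw [hb, pow_add]; push_cast; field_simp
    · refine ⟨a * n ^ K, ?_⟩
      rw [show i = m + 1 by omega, hk, pow_add]; push_cast; field_simp

lemma exists_piece_lt {t : ℕ → ℝ} {m : ℕ} {x : ℝ} (h0 : t 0 ≤ x) (h1 : x < t m) :
    ∃ i < m, t i ≤ x ∧ x < t (i + 1) := by
  induction m with
  | zero => linarith
  | succ m ih =>
    rcases le_or_gt (t m) x with h | h
    · exact ⟨m, by omega, h, h1⟩
    · obtain ⟨i, hi, h⟩ := ih h
      exact ⟨i, by omega, h⟩

lemma hasPair_of_inT {n : ℕ} (hn : 2 ≤ n) {f : Circle ≃ₜ Circle} (hf : InT n f) : ∃ k, HasPair n k f := by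
  have hn0 : (0 : ℝ) < n := by positivity
  obtain ⟨him, F, hmono, hlift, -, m, t, s, c, hm, t0, tm, ht, hta, hp⟩ := hf
  have hFt : ∀ i ≤ m, IsNAdic n (F (t i)) := by
    intro i hi
    have : f (t i) ∈ nAdicPoints n := by
      rw [← him]; exact ⟨_, ⟨t i, hta i hi, rfl⟩, rfl⟩
    obtain ⟨x, hx, hx'⟩ := this
    rw [hlift] at hx'
    obtain ⟨z, hz⟩ := coe_eq.1 hx'
    rw [hz]; exact hx.add hn (IsNAdic.int z)
  obtain ⟨K1, hK1⟩ := common_exp hn m hta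
  obtain ⟨K2, hK2⟩ := common_exp hn m hFt
  obtain ⟨M, hM⟩ : ∃ M : ℕ, ∀ i < m, |s i| ≤ M := by
    refine ⟨∑ i ∈ Finset.range m, (s i).natAbs, fun i hi => ?_⟩
    rw [Int.abs_eq_natAbs]
    exact_mod_cast Finset.single_le_sum (f := fun i => (s i).natAbs) (fun _ _ => Nat.zero_le _)
      (Finset.mem_range.2 hi)
  set K := K1 + K2 + M with hK
  obtain ⟨k, G, hG, hGp⟩ := uniform hn K
  have key : LvLe n (K + M) f G := by
    intro a b hab
    have hl := (hGp a b).1 hab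
    have hbd := hl.bd hn
    obtain ⟨A, hA, rfl, rfl⟩ := hl
    obtain ⟨i, hi, hti, hti1⟩ := exists_piece_lt (t := t) (m := m) (x := A / (n : ℝ) ^ K)
      (by rw [t0]; exact hbd.1) (by rw [tm]; linarith)
    have hs := abs_le.1 (hM i hi)
    obtain ⟨T, hT⟩ := hK1 i (by omega)
    obtain ⟨T', hT'⟩ := hK1 (i + 1) (by omega)
    obtain ⟨U, hU⟩ := hK2 i (by omega)
    have hb : (A + 1) / (n : ℝ) ^ K ≤ t (i + 1) := by
      have e : t (i + 1) = ((T' * n ^ (K2 + M) : ℤ) : ℝ) / (n : ℝ) ^ K := by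
        rw [hT', hK, show K1 + K2 + M = K1 + (K2 + M) by ring, pow_add (n : ℝ) K1]; push_cast; field_simp
      rw [e, div_lt_div_iff_of_pos_right (by positivity)] at hti1
      rw [e, div_le_div_iff_of_pos_right (by positivity)]
      have : ((A : ℤ) : ℝ) < ((T' * n ^ (K2 + M) : ℤ) : ℝ) := by simpa using hti1
      have : (A : ℤ) + 1 ≤ (T' * n ^ (K2 + M) : ℤ) := by exact_mod_cast this
      exact_mod_cast this
    obtain ⟨l, hlK⟩ : ∃ l : ℕ, (l : ℤ) = K - s i := ⟨(K - s i).toNat, by omega⟩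
    obtain ⟨q, hq⟩ : ∃ q : ℕ, l = K2 + q := ⟨l - K2, by omega⟩
    have hns : (n : ℝ) ^ s i = n ^ K / n ^ l := by
      rw [show s i = (K : ℤ) - l by omega, zpow_sub₀ hn0.ne']; simp
    let B : ℤ := U * n ^ q + (A - T * n ^ (K2 + M))
    have hval : ∀ x, A / (n : ℝ) ^ K ≤ x → x ≤ (A + 1) / (n : ℝ) ^ K →
        F x = (B + (x * n ^ K - A)) / n ^ l := by
      intro x hx hx'
      have e1 := hp i hi x ⟨by linarith, by linarith⟩
      have e2 := hp i hi (t i) ⟨le_rfl, (ht i hi).le⟩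
      have e3 : F x = F (t i) + n ^ s i * (x - t i) := by rw [e1, e2]; ring
      rw [e3, hU, hT, hns]
      simp only [B]
      rw [hq, hK, show K1 + K2 + M = K1 + (K2 + M) by ring, pow_add (n : ℝ) K1, pow_add (n : ℝ) K2 q]
      push_cast
      field_simp
      ring
    have hpos : (0 : ℤ) < (n : ℤ) ^ l := by positivity
    have hmod0 := Int.emod_nonneg B hpos.ne'
    have hmod1 := Int.emod_lt_of_pos B hpos
    obtain ⟨R, hR⟩ := Int.eq_ofNat_of_zero_le hmod0
    have hdiv := Int.emod_add_mul_ediv B (n ^ l)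
    refine ⟨l, by omega, _, _, ⟨R, ?_, rfl, rfl⟩, ?_⟩
    · rw [hR] at hmod1; exact_mod_cast hmod1
    · intro u hu hu1
      have hw : ((A : ℝ) + 1) / n ^ K - A / n ^ K = 1 / n ^ K := by ring
      have h1 : (A : ℝ) / n ^ K ≤ A / n ^ K + u * ((A + 1) / n ^ K - A / n ^ K) := by
        rw [hw]
        have : 0 ≤ u * (1 / (n : ℝ) ^ K) := by positivity
        linarith
      have h2 : (A : ℝ) / n ^ K + u * ((A + 1) / n ^ K - A / n ^ K) ≤ (A + 1) / n ^ K := by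
        have h3 : u * (1 / (n : ℝ) ^ K) ≤ 1 * (1 / n ^ K) := by gcongr
        rw [hw]; rw [one_mul] at h3; linarith
      rw [hlift, hval _ h1 h2, coe_eq]
      refine ⟨B / n ^ l, ?_⟩
      have hB : (B : ℝ) = R + n ^ l * (B / n ^ l : ℤ) := by
        rw [hR] at hdiv
        exact_mod_cast hdiv.symm
      rw [hB]
      field_simp
      ring
  obtain ⟨k', P', hP', h'⟩ := refine_to hn (n ^ (K + M)) k G (by omega) hG key
  obtain ⟨k2, G2, hG2, hG2p⟩ := uniform hn (K + M)
  have good : Good f P' G2 := by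
    apply good_of_forward (wf_std hn hP') (wf_std hn hG2)
    intro a b hab
    obtain ⟨c, d, hl, hA⟩ := h' a b hab
    exact ⟨c, d, (hG2p c d).2 hl, hA⟩
  have := card_good hn hP' hG2 good
  subst this
  exact ⟨k', P', G2, hP', hG2, good⟩

lemma hasPair_Tn {n : ℕ} (hn : 2 ≤ n) {f : Circle ≃ₜ Circle} (hf : f ∈ Tn n) : ∃ k, HasPair n k f := by
  unfold Tn at hf
  induction hf using Subgroup.closure_induction with
  | mem x hx => exact hasPair_of_inT hn hx
  | one => exact ⟨0, HasPair.one⟩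
  | mul x y _ _ hx hy =>
    obtain ⟨k, hk⟩ := hx
    obtain ⟨l, hl⟩ := hy
    obtain ⟨m, -, hm⟩ := HasPair.mul hn hk hl
    exact ⟨m, hm⟩
  | inv x _ hx =>
    obtain ⟨k, hk⟩ := hx
    exact ⟨k, hk.inv⟩

lemma caret_le {n : ℕ} (hn : 2 ≤ n) {f : Circle ≃ₜ Circle} {k : ℕ} (h : HasPair n k f) :
    caretNumber n f ≤ k := by
  obtain ⟨P, Q, hP, hQ, hg⟩ := h
  exact Nat.sInf_le ⟨P, hP, good_affine hg, Q, hQ, good_circlePts (wf_std hn hP) (wf_std hn hQ) hg⟩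

lemma caret_attained {n : ℕ} (hn : 2 ≤ n) {f : Circle ≃ₜ Circle} (hf : f ∈ Tn n) :
    HasPair n (caretNumber n f) f := by
  have hne : { k : ℕ | ∃ P : Finset ℝ, IsStdSubdiv n k P ∧ AffineOnParts P f ∧
    ∃ Q : Finset ℝ, IsStdSubdiv n k Q ∧ f '' circlePts P = circlePts Q }.Nonempty := by
    obtain ⟨k, P, Q, hP, hQ, hg⟩ := hasPair_Tn hn hf
    exact ⟨k, P, hP, good_affine hg, Q, hQ, good_circlePts (wf_std hn hP) (wf_std hn hQ) hg⟩
  obtain ⟨P, hP, hA, Q, hQ, hI⟩ := Nat.sInf_mem hne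
  exact ⟨P, Q, hP, hQ, good_of_affine (orient_Tn hf) (wf_std hn hP) (wf_std hn hQ) hA hI⟩

lemma caret_mul {n : ℕ} (hn : 2 ≤ n) {f g : Circle ≃ₜ Circle} {k : ℕ} (hg : HasPair n k g)
    (hf : f ∈ Tn n) : caretNumber n (g * f) ≤ caretNumber n f + k := by
  obtain ⟨l, hl, h⟩ := HasPair.mul hn hg (caret_attained hn hf)
  exact (caret_le hn h).trans hl

def WL {Γ : Type*} [Group Γ] (S : Set Γ) (k : ℕ) (g : Γ) : Prop :=
  ∃ w : List Γ, w.length ≤ k ∧ (∀ x ∈ w, x ∈ S ∨ x⁻¹ ∈ S) ∧ w.prod = g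

section
variable {Γ : Type*} [Group Γ] {S : Set Γ}
lemma WL.one {k : ℕ} : WL S k 1 := ⟨[], by simp, by simp, by simp⟩

lemma WL.gen {g : Γ} (h : g ∈ S ∨ g⁻¹ ∈ S) : WL S 1 g := ⟨[g], by simp, by simpa using h, by simp⟩

lemma WL.mul {k l : ℕ} {g h : Γ} (hg : WL S k g) (hh : WL S l h) : WL S (k + l) (g * h) := by
  obtain ⟨w, h1, h2, rfl⟩ := hg
  obtain ⟨w', h3, h4, rfl⟩ := hh
  refine ⟨w ++ w', by simp; omega, ?_, by simp⟩
  intro x hx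
  rcases List.mem_append.1 hx with h | h
  · exact h2 x h
  · exact h4 x h

lemma WL.mono {k l : ℕ} {g : Γ} (hg : WL S k g) (h : k ≤ l) : WL S l g := by
  obtain ⟨w, h1, h2⟩ := hg
  exact ⟨w, by omega, h2⟩

lemma WL.inv {k : ℕ} {g : Γ} (hg : WL S k g) : WL S k g⁻¹ := by
  obtain ⟨w, h1, h2, rfl⟩ := hg
  refine ⟨(w.map (fun x => x⁻¹)).reverse, by simpa using h1, ?_, (List.prod_inv_reverse w).symm⟩
  intro x hx
  simp only [List.mem_reverse, List.mem_map] at hx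
  obtain ⟨y, hy, rfl⟩ := hx
  rw [inv_inv]; exact (h2 y hy).symm

lemma WL.pow {g : Γ} (h : g ∈ S ∨ g⁻¹ ∈ S) (k : ℕ) : WL S k (g ^ k) := by
  induction k with
  | zero => simpa using WL.one
  | succ k ih => rw [pow_succ]; exact ih.mul (WL.gen h)

lemma WL.closure {k : ℕ} {g : Γ} (h : WL S k g) : g ∈ Subgroup.closure S := by
  obtain ⟨w, -, h2, rfl⟩ := h
  apply Subgroup.list_prod_mem
  intro x hx
  rcases h2 x hx with h | h
  · exact Subgroup.subset_closure h
  · simpa using Subgroup.inv_mem _ (Subgroup.subset_closure h)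
end

lemma good_uniq_aux {f : Circle ≃ₜ Circle} {P Q R : Finset ℝ} (hQ : Wf Q) (hR : Wf R)
    (h : Good f P Q) (h' : Good f P R) : Q ⊆ R := by
  intro a ha
  obtain ⟨b, hb⟩ := exists_next hQ ha
  obtain ⟨c, d, hc, hA⟩ := h.2 a b hb
  obtain ⟨a', b', ha', hA'⟩ := h'.1 c d hc
  have e : (a : Circle) = a' := by rw [← hA.left, ← hA'.left]
  have := coe_inj (hQ.2 a ha).1 (hQ.2 a ha).2 (hR.2 a' ha'.1).1 (hR.2 a' ha'.1).2 e
  rw [this]; exact ha'.1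

lemma good_uniq {f : Circle ≃ₜ Circle} {P Q R : Finset ℝ} (hQ : Wf Q) (hR : Wf R)
    (h : Good f P Q) (h' : Good f P R) : Q = R :=
  Finset.Subset.antisymm (good_uniq_aux hQ hR h h') (good_uniq_aux hR hQ h' h)

lemma steps_count {n : ℕ} (hn : 2 ≤ n) {k s s' l : ℕ} {P Q R : Finset ℝ} (hP : IsStdSubdiv n k P)
    (hQ : IsStdSubdiv n l Q) (h : Steps n s P R) (h' : Steps n s' Q R) : k + s = l + s' := by
  have h1 := card_std hn (std_of_steps h hP)
  have h2 := card_std hn (std_of_steps h' hQ)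
  rw [h1] at h2
  exact Nat.eq_of_mul_eq_mul_right (by omega : 0 < n - 1) (Nat.succ_injective h2)

def wI (n i : ℕ) : ℕ := (i - 1) / (n - 1)
def eI (n i : ℕ) : ℕ := i - (n - 1) * wI n i

lemma wI_mono {n i j : ℕ} (h : i ≤ j) : wI n i ≤ wI n j := Nat.div_le_div_right (by omega)

lemma wI_le {n i k : ℕ} (hn : 2 ≤ n) (h : i ≤ (n - 1) * k) : wI n i ≤ k := by
  unfold wI
  calc (i - 1) / (n - 1) ≤ ((n - 1) * k) / (n - 1) := Nat.div_le_div_right (by omega)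
    _ = k := Nat.mul_div_cancel_left _ (by omega)

lemma eI_spec {n i : ℕ} (hn : 2 ≤ n) (hi : 1 ≤ i) :
    1 ≤ eI n i ∧ eI n i ≤ n - 1 ∧ i = (n - 1) * wI n i + eI n i := by
  unfold eI wI
  have h1 := Nat.div_add_mod (i - 1) (n - 1)
  have h2 := Nat.mod_lt (i - 1) (show n - 1 > 0 by omega)
  omega

structure Gens (n : ℕ) (S : Set (Circle ≃ₜ Circle)) (x : ℕ → (Circle ≃ₜ Circle)) (r : Circle ≃ₜ Circle) : Prop where
  spec : ∀ i, XSpec n i (x i)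
  mem : ∀ i < n, x i ∈ S
  rot : Good r (VV n 1) (VV n 1)
  rapp : ∀ t : ℝ, r t = ((t + 1 / n : ℝ) : Circle)
  rmem : r ∈ S
  sub : ∀ g ∈ S, g ∈ Tn n

section
variable {n : ℕ} (hn : 2 ≤ n) {S : Set (Circle ≃ₜ Circle)} {x : ℕ → (Circle ≃ₜ Circle)}
  {r : Circle ≃ₜ Circle} (H : Gens n S x r)
include hn H

lemma conj_spec {e : ℕ} (he : 1 ≤ e) (w : ℕ) :
    XSpec n ((n - 1) * w + e) (x 0 ^ w * x e * (x 0 ^ w)⁻¹) := by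
  induction w with
  | zero => simpa using H.spec e
  | succ w ih =>
    have := XSpec.conj hn (H.spec 0) ih (by omega)
    rw [show (n - 1) * (w + 1) + e = (n - 1) * w + e + (n - 1) by rw [Nat.mul_succ]; ring]
    convert this using 1
    rw [pow_succ']; group

lemma exists_XX (i : ℕ) : ∃ X, XSpec n i X ∧ WL S 1 ((x 0 ^ wI n i)⁻¹ * X * x 0 ^ wI n i) := by
  rcases Nat.eq_zero_or_pos i with rfl | hi
  · refine ⟨x 0, H.spec 0, ?_⟩
    simp only [wI, zero_tsub, Nat.zero_div, pow_zero, inv_one, one_mul, mul_one]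
    exact WL.gen (Or.inl (H.mem 0 (by omega)))
  · obtain ⟨h1, h2, h3⟩ := eI_spec hn hi
    refine ⟨x 0 ^ wI n i * x (eI n i) * (x 0 ^ wI n i)⁻¹, ?_, ?_⟩
    · have := conj_spec hn H h1 (wI n i)
      rwa [← h3] at this
    · have : (x 0 ^ wI n i)⁻¹ * (x 0 ^ wI n i * x (eI n i) * (x 0 ^ wI n i)⁻¹) * x 0 ^ wI n i
          = x (eI n i) := by group
      rw [this]
      exact WL.gen (Or.inl (H.mem _ (by omega)))

lemma norm_claim (T : ℕ) : ∀ (s k : ℕ) (P : Finset ℝ) (i0 : ℕ), Steps n s (VV n k) P →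
    i0 ≤ (n - 1) * k → (∀ i < i0, ∀ s', ¬ Steps n s' (vs n k i) P) → k + s ≤ T →
    ∃ g, Good g P (VV n (k + s)) ∧ g 0 = 0 ∧ ∃ c, c + wI n i0 ≤ s + 2 * T ∧
      WL S c (g * x 0 ^ wI n i0) := by
  have hx0 : x 0 ∈ S ∨ (x 0)⁻¹ ∈ S := Or.inl (H.mem 0 (by omega))
  intro s
  induction s with
  | zero =>
    intro k P i0 hs hi0 hno hT
    cases hs
    refine ⟨1, Good.one, rfl, wI n i0, ?_, ?_⟩
    · have := wI_le hn hi0; omega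
    · rw [one_mul]; exact WL.pow hx0 _
  | succ s ih =>
    intro k P i0 hs hi0 hno hT
    have hPw : Wf P := wf_steps hn hs (wf_vine hn k)
    by_cases hex : ∃ i, i < (n - 1) * k ∧ ∃ s', Steps n s' (vs n k i) P
    · classical
      obtain ⟨hi1, s', hs'⟩ := Nat.find_spec hex
      have hmin := fun m (hm : m < Nat.find hex) => Nat.find_min hex hm
      set i1 := Nat.find hex with hi1def
      have hi01 : i0 ≤ i1 := by
        by_contra h
        exact hno i1 (by omega) s' hs'
      have hp1 := part_v hn hi1
      have hstep : Step n (VV n k) (vs n k i1) := ⟨_, _, hp1, rfl⟩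
      have hvs : IsStdSubdiv n (k + 1) (vs n k i1) := std_of_steps (Steps.single hstep) (std_vine hn k)
      have hss : s' = s := by
        have := steps_count hn (std_vine hn k) hvs hs hs'
        omega
      subst hss
      obtain ⟨X, hX, hXw⟩ := exists_XX hn H i1
      have hgood := hX.good hn hi1
      have wf1 := wf_std hn hvs
      have wf2 := wf_vine hn (k + 1)
      obtain ⟨P1, hP1, hG1⟩ := Good.steps hn hs' wf1 wf2 hgood
      have wfP1 := wf_steps hn hP1 wf2
      have hk : (n - 1) * (k + 1) = (n - 1) * k + (n - 1) := Nat.mul_succ _ _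
      obtain ⟨g, hg, hg0, c, hc, hw⟩ := ih (k + 1) P1 i1 hP1 (by omega) (by
        intro i hi s'' hs''
        apply hmin i hi
        refine ⟨by omega, s'' + 1, ?_⟩
        have hpi : Parts (VV n (k + 1)) (vn n i) (vn n (i + 1)) := part_v hn (by omega)
        have hpi' : Parts (VV n k) (vn n i) (vn n (i + 1)) := part_v hn (by omega)
        have hne : vn n i ≠ vn n i1 := ((vn_strictMono hn) hi).ne
        have hpi2 : Parts (vs n k i1) (vn n i) (vn n (i + 1)) := parts_sp_old hn hp1 hpi' hne
        have hsp := hgood.inv.split hn wf2 wf1 hpi hpi2 (hX.fix i hi).inv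
        obtain ⟨P2, hP2, hG2⟩ := Good.steps hn hs'' (wf_sp hn wf2 hpi) (wf_sp hn wf1 hpi2) hsp
        have hP2w := wf_steps hn hP2 (wf_sp hn wf1 hpi2)
        have : P2 = P := good_uniq hP2w hPw hG2 hG1.inv
        subst this
        refine Steps.head _ _ _ _ ⟨_, _, parts_sp_old hn hpi' hp1 hne.symm, ?_⟩ hP2
        exact sp_comm _ _ _ _ _) (by omega)
      have hm := wI_mono (n := n) hi01
      refine ⟨g * X, ?_, ?_, c + 1 + (wI n i1 - wI n i0), by omega, ?_⟩
      · rw [show k + (s' + 1) = k + 1 + s' by ring]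
        exact hg.comp hG1
      · rw [mul_app, hX.zero hn, hg0]
      · have e : g * X * x 0 ^ wI n i0 = g * x 0 ^ wI n i1 * ((x 0 ^ wI n i1)⁻¹ * X * x 0 ^ wI n i1) *
            (x 0 ^ (wI n i1 - wI n i0))⁻¹ := by
          rw [pow_sub _ hm]; group
        rw [e]
        exact (hw.mul hXw).mul (WL.pow hx0 _).inv
    · cases hs with
      | head _ _ P' _ h1 h2 =>
      obtain ⟨a, b, hab, rfl⟩ := h1
      rcases (parts_vine hn).1 hab with ⟨i, hi, rfl, rfl⟩ | ⟨rfl, rfl⟩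
      · exact absurd ⟨i, hi, s, h2⟩ hex
      have hk : (n - 1) * (k + 1) = (n - 1) * k + (n - 1) := Nat.mul_succ _ _
      obtain ⟨g, hg, hg0, c, hc, hw⟩ := ih (k + 1) P i0 h2 (by omega) (by
        intro i hi s' hs'
        apply hno i hi (s' + 1)
        have hpi := part_v hn (show i < (n - 1) * k by omega)
        have hne : vn n ((n - 1) * k) ≠ vn n i := ((vn_strictMono hn) (show i < (n - 1) * k by omega)).ne'
        refine Steps.head _ _ _ _ ⟨_, _, parts_sp_old hn hpi hab hne, ?_⟩ hs'
        exact sp_comm _ _ _ _ _) (by omega)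
      refine ⟨g, ?_, hg0, c, by omega, hw⟩
      rw [show k + (s + 1) = k + 1 + s by ring]; exact hg

lemma norm {N : ℕ} {P : Finset ℝ} (hP : IsStdSubdiv n N P) :
    ∃ g, Good g P (VV n N) ∧ g 0 = 0 ∧ WL S (3 * N) g := by
  obtain ⟨g, h1, h2, c, hc, hw⟩ := norm_claim hn H N N 0 P 0 (steps_of_std hP) (by omega)
    (by intro i hi; omega) (by omega)
  refine ⟨g, by simpa using h1, h2, ?_⟩
  have e : wI n 0 = 0 := by simp [wI]
  rw [e, pow_zero, mul_one] at hw
  exact hw.mono (by omega)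

lemma x0_steps (i : ℕ) {k : ℕ} (hk : 1 ≤ k) :
    ∃ P, Steps n i (VV n k) P ∧ Good (x 0 ^ i)⁻¹ (VV n (k + i)) P := by
  induction i with
  | zero => exact ⟨_, Steps.refl _, by simpa using Good.one⟩
  | succ i ih =>
    obtain ⟨P, h1, h2⟩ := ih
    have hpos : 0 < (n - 1) * (k + i) := Nat.mul_pos (by omega) (by omega)
    have hst : Steps n 1 (VV n (k + i)) (vs n (k + i) 0) := Steps.single ⟨_, _, part_v hn hpos, rfl⟩
    have hg := ((H.spec 0).good hn hpos).inv
    obtain ⟨Q, h3, h4⟩ := Good.steps hn hst (wf_vine hn _) (wf_steps hn h1 (wf_vine hn k)) h2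
    refine ⟨Q, h1.trans h3, ?_⟩
    have := h4.comp hg
    rw [pow_succ', mul_inv_rev]
    exact this

lemma x0_app (i : ℕ) {e : ℕ} (he : 1 ≤ e) :
    (x 0 ^ i) ((vn n e : ℝ) : Circle) = ((vn n ((n - 1) * i + e) : ℝ) : Circle) := by
  induction i with
  | zero => simp [one_app]
  | succ i ih =>
    rw [pow_succ', mul_app, ih, ((H.spec 0).shift ((n - 1) * i + e) (by omega)).left, Nat.mul_succ]
    congr 2; ring

lemma r_app (e : ℕ) : (r ^ e) 0 = ((e / n : ℝ) : Circle) := by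
  induction e with
  | zero => simp [one_app]
  | succ e ih =>
    rw [pow_succ', mul_app, ih, H.rapp]
    congr 1; push_cast; ring

lemma r_good (e : ℕ) : Good (r ^ e) (VV n 1) (VV n 1) := by
  induction e with
  | zero => exact Good.one
  | succ e ih => rw [pow_succ']; exact H.rot.comp ih

lemma vine_steps (k : ℕ) : Steps n k (VV n 1) (VV n (1 + k)) := by
  induction k with
  | zero => exact Steps.refl _
  | succ k ih => exact ih.trans (Steps.single (step_vine hn (1 + k)))

lemma rotate {N j : ℕ} (hj : j ≤ (n - 1) * N) : ∃ g, Good g (VV n N) (VV n N) ∧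
    g ((vn n j : ℝ) : Circle) = 0 ∧ WL S (4 * N + n) g := by
  have hx0 : x 0 ∈ S ∨ (x 0)⁻¹ ∈ S := Or.inl (H.mem 0 (by omega))
  rcases Nat.eq_zero_or_pos j with rfl | hj0
  · exact ⟨1, Good.one, by simp [one_app, vn_zero], WL.one⟩
  obtain ⟨h1, h2, h3⟩ := eI_spec hn hj0
  set i := wI n j
  set e := eI n j
  have hi : i < N := by
    by_contra h
    have : (n - 1) * N ≤ (n - 1) * i := Nat.mul_le_mul_left _ (by omega)
    omega
  obtain ⟨k, rfl⟩ : ∃ k, N = 1 + k + i := ⟨N - i - 1, by omega⟩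
  obtain ⟨P, hP, hG⟩ := x0_steps hn H i (k := 1 + k) (by omega)
  have hP1 := (vine_steps hn H k).trans hP
  obtain ⟨Q, hQ, hG2⟩ := Good.steps hn hP1 (wf_vine hn 1) (wf_vine hn 1) (r_good hn H e).inv
  have hstd := std_of_steps hQ (std_vine hn 1)
  rw [← add_assoc] at hstd
  obtain ⟨h, hh, hh0, hw⟩ := norm hn H hstd
  refine ⟨h * ((r ^ e)⁻¹ * (x 0 ^ i)⁻¹), hh.comp (hG2.comp hG), ?_, ?_⟩
  · rw [mul_app, mul_app]
    have e1 : (vn n e : ℝ) = e / n := by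
      have := vn_add hn 0 e h2
      simpa [vn_zero] using this
    rw [h3, ← x0_app hn H i h1, inv_app_app, e1, ← r_app hn H e, inv_app_app, hh0]
  · exact (hw.mul ((WL.pow (Or.inl H.rmem) e).inv.mul (WL.pow hx0 i).inv)).mono (by omega)

lemma wl_tn {k : ℕ} {g : Circle ≃ₜ Circle} (h : WL S k g) : g ∈ Tn n :=
  (Subgroup.closure_le (Tn n)).2 H.sub h.closure

lemma upper {f : Circle ≃ₜ Circle} (hf : f ∈ Tn n) : WL S (10 * caretNumber n f + n) f := by
  obtain ⟨P, Q, hP, hQ, hgood⟩ := caret_attained hn hf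
  set N := caretNumber n f
  obtain ⟨g, hg, hg0, hgw⟩ := norm hn H hP
  obtain ⟨h, hh, hh0, hhw⟩ := norm hn H hQ
  have hu := hh.comp (hgood.comp hg.inv)
  have hwf := wf_vine hn N
  obtain ⟨b, hb⟩ := exists_next hwf hwf.1
  obtain ⟨c, d, hcd, hA⟩ := hu.1 0 b hb
  obtain ⟨j, hj, rfl⟩ : ∃ j ≤ (n - 1) * N, c = vn n j := by
    rcases (parts_vine hn).1 hcd with ⟨i, hi, rfl, -⟩ | ⟨rfl, -⟩
    · exact ⟨i, hi.le, rfl⟩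
    · exact ⟨_, le_rfl, rfl⟩
  obtain ⟨q, hq, hq0, hqw⟩ := rotate hn H hj
  have h1 : q * (h * (f * g⁻¹)) = 1 := by
    apply eq_one_of_good _ hwf (hq.comp hu)
    · rw [mul_app]
      have := hA.left
      rw [show ((0 : ℝ) : Circle) = 0 from rfl] at this
      rw [this, hq0]
    · exact (orient_Tn (wl_tn hn H hqw)).mul ((orient_Tn (wl_tn hn H hhw)).mul
        ((orient_Tn hf).mul (orient_Tn (wl_tn hn H hgw)).inv))
  have h2 : f = h⁻¹ * q⁻¹ * g := by
    have : f = h⁻¹ * q⁻¹ * (q * (h * (f * g⁻¹))) * g := by group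
    rw [h1, mul_one] at this
    exact this
  rw [h2]
  exact ((hhw.inv.mul hqw.inv).mul hgw).mono (by omega)
end

lemma gen_pair {n : ℕ} (hn : 2 ≤ n) {i : ℕ} (hi : i < n) {f : Circle ≃ₜ Circle} (h : XSpec n i f) :
    HasPair n 3 f := by
  have hi' : i < (n - 1) * 2 := by omega
  exact ⟨vs n 2 i, VV n 3, std_of_steps (Steps.single ⟨_, _, part_v hn hi', rfl⟩) (std_vine hn 2),
    std_vine hn 3, h.good hn hi'⟩

/-- Let `n ≥ 2`.  There exists a finite generating set `Σ` of `T_n`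
with `n+1` elements such that for every `ω ∈ T_n`,
`N(ω)/3 ≤ |ω|_Σ ≤ 15(n-1)·N(ω) + 3n`, where `N(ω)` is the caret number of `ω`. -/
theorem word_length_caret_estimate (n : ℕ) (hn : 2 ≤ n) :
    ∃ S : Finset (Tn n), S.card = n + 1 ∧
      Subgroup.closure (S : Set (Tn n)) = ⊤ ∧
      ∀ ω : Tn n,
        (caretNumber n (ω : Circle ≃ₜ Circle) : ℝ) / 3 ≤
            (wordLength (S : Set (Tn n)) ω : ℝ) ∧
        (wordLength (S : Set (Tn n)) ω : ℝ) ≤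
            15 * ((n : ℝ) - 1) * (caretNumber n (ω : Circle ≃ₜ Circle) : ℝ) + 3 * n := by
  classical
  choose x hxT hx using fun i => exists_X hn i
  obtain ⟨r, hrT, hr, hrapp⟩ := exists_rot hn
  have mT : ∀ f, InT n f → f ∈ Tn n := fun f hf => Subgroup.subset_closure hf
  let y : ℕ → Tn n := fun i => ⟨x i, mT _ (hxT i)⟩
  let ρ : Tn n := ⟨r, mT _ hrT⟩
  have hyinj : ∀ i j, y i = y j → i = j := by
    intro i j h
    have h : x i = x j := congrArg Subtype.val h
    rcases lt_trichotomy i j with h1 | h1 | h1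
    · exact (XSpec.ne hn (hx i) (h ▸ hx j) h1).elim
    · exact h1
    · exact (XSpec.ne hn (hx j) (h ▸ hx i) h1).elim
  have hρ : ∀ i, y i ≠ ρ := by
    intro i h
    have h : x i = r := congrArg Subtype.val h
    have h0 := (hx i).zero hn
    rw [h, show (0 : Circle) = ((0 : ℝ) : Circle) from rfl, hrapp] at h0
    have hn1 : (1 : ℝ) < n := by exact_mod_cast hn
    have := coe_inj (by positivity) (by rw [zero_add, div_lt_one (by linarith)]; exact hn1)
      le_rfl one_pos h0
    rw [zero_add] at this
    have h2 : 0 < 1 / (n : ℝ) := by positivity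
    linarith
  let S : Finset (Tn n) := insert ρ ((Finset.range n).image y)
  have hyS : ∀ i < n, y i ∈ S := fun i hi =>
    Finset.mem_insert_of_mem (Finset.mem_image_of_mem _ (Finset.mem_range.2 hi))
  have hρS : ρ ∈ S := Finset.mem_insert_self _ _
  have hcard : S.card = n + 1 := by
    rw [Finset.card_insert_of_notMem, Finset.card_image_of_injective _ (fun i j h => hyinj i j h),
      Finset.card_range]
    intro h
    obtain ⟨i, -, hi⟩ := Finset.mem_image.1 h
    exact hρ i hi
  let S0 : Set (Circle ≃ₜ Circle) := Subtype.val '' (S : Set (Tn n))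
  have H : Gens n S0 x r := ⟨hx, fun i hi => ⟨y i, hyS i hi, rfl⟩, hr, hrapp, ⟨ρ, hρS, rfl⟩, by
    rintro _ ⟨g, -, rfl⟩; exact g.2⟩
  have lift : ∀ w : List (Circle ≃ₜ Circle), (∀ z ∈ w, z ∈ S0 ∨ z⁻¹ ∈ S0) →
      ∃ w' : List (Tn n), w'.length = w.length ∧
        (∀ z ∈ w', z ∈ (S : Set (Tn n)) ∨ z⁻¹ ∈ (S : Set (Tn n))) ∧ (w'.prod : Circle ≃ₜ Circle) = w.prod := by
    intro w
    induction w with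
    | nil => intro _; exact ⟨[], rfl, by simp, by simp⟩
    | cons a w ih =>
      intro hw
      obtain ⟨w', h1, h2, h3⟩ := ih (fun z hz => hw z (List.mem_cons_of_mem _ hz))
      obtain ⟨a', ha', ha⟩ : ∃ a' : Tn n, (a' ∈ (S : Set (Tn n)) ∨ a'⁻¹ ∈ (S : Set (Tn n))) ∧
          (a' : Circle ≃ₜ Circle) = a := by
        rcases hw a List.mem_cons_self with ⟨g, hg, hga⟩ | ⟨g, hg, hga⟩
        · exact ⟨g, Or.inl hg, hga⟩
        · exact ⟨g⁻¹, Or.inr (by simpa using hg), by rw [Subgroup.coe_inv, hga, inv_inv]⟩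
      refine ⟨a' :: w', by simp [h1], ?_, by
        rw [List.prod_cons, List.prod_cons, Subgroup.coe_mul, h3, ha]⟩
      intro z hz
      rcases List.mem_cons.1 hz with rfl | hz
      · exact ha'
      · exact h2 z hz
  have hWL : ∀ ω : Tn n, WL (S : Set (Tn n)) (10 * caretNumber n (ω : Circle ≃ₜ Circle) + n) ω := by
    intro ω
    obtain ⟨w, h1, h2, h3⟩ := upper hn H ω.2
    obtain ⟨w', h4, h5, h6⟩ := lift w h2
    exact ⟨w', by omega, h5, Subtype.ext (h6.trans h3)⟩
  refine ⟨S, hcard, ?_, fun ω => ⟨?_, ?_⟩⟩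
  · rw [eq_top_iff]
    intro ω _
    exact (hWL ω).closure
  · have hgp : ∀ g ∈ S, HasPair n 3 (g : Circle ≃ₜ Circle) ∨ HasPair n 1 (g : Circle ≃ₜ Circle) := by
      intro g hg
      rcases Finset.mem_insert.1 hg with rfl | hg
      · exact Or.inr ⟨_, _, std_vine hn 1, std_vine hn 1, hr⟩
      · obtain ⟨i, hi, rfl⟩ := Finset.mem_image.1 hg
        exact Or.inl (gen_pair hn (Finset.mem_range.1 hi) (hx i))
    have hgp2 : ∀ g : Tn n, (g ∈ (S : Set (Tn n)) ∨ g⁻¹ ∈ (S : Set (Tn n))) →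
        ∃ k ≤ 3, HasPair n k (g : Circle ≃ₜ Circle) := by
      rintro g (hg | hg)
      · rcases hgp g hg with h | h
        · exact ⟨3, le_rfl, h⟩
        · exact ⟨1, by omega, h⟩
      · rcases hgp _ hg with h | h
        · exact ⟨3, le_rfl, by simpa using h.inv⟩
        · exact ⟨1, by omega, by simpa using h.inv⟩
    have hlow : ∀ w : List (Tn n), (∀ z ∈ w, z ∈ (S : Set (Tn n)) ∨ z⁻¹ ∈ (S : Set (Tn n))) →
        caretNumber n (w.prod : Circle ≃ₜ Circle) ≤ 3 * w.length := by
      intro w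
      induction w with
      | nil => intro _; exact caret_le hn (by simpa using HasPair.one)
      | cons a w ih =>
        intro hw
        have h1 := ih (fun z hz => hw z (List.mem_cons_of_mem _ hz))
        obtain ⟨k, hk, hp⟩ := hgp2 a (hw a List.mem_cons_self)
        have := caret_mul hn hp (w.prod).2
        rw [List.prod_cons, Subgroup.coe_mul, List.length_cons]
        omega
    have hne : { k : ℕ | ∃ w : List (Tn n), w.length = k ∧
        (∀ x ∈ w, x ∈ (S : Set (Tn n)) ∨ x⁻¹ ∈ (S : Set (Tn n))) ∧ w.prod = ω }.Nonempty := by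
      obtain ⟨w, -, h2, h3⟩ := hWL ω
      exact ⟨_, w, rfl, h2, h3⟩
    obtain ⟨w, h1, h2, h3⟩ := Nat.sInf_mem hne
    have h4 := hlow w h2
    rw [h3, h1] at h4
    have h5 : (caretNumber n (ω : Circle ≃ₜ Circle) : ℝ) ≤ 3 * (wordLength (S : Set (Tn n)) ω : ℝ) := by
      exact_mod_cast h4
    linarith
  · obtain ⟨w, h1, h2, h3⟩ := hWL ω
    have h4 : wordLength (S : Set (Tn n)) ω ≤ 10 * caretNumber n (ω : Circle ≃ₜ Circle) + n :=
      le_trans (by unfold wordLength; exact Nat.sInf_le ⟨w, rfl, h2, h3⟩) h1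
    have h5 : (wordLength (S : Set (Tn n)) ω : ℝ) ≤ 10 * (caretNumber n (ω : Circle ≃ₜ Circle) : ℝ) + n := by
      exact_mod_cast h4
    have hn2 : (2 : ℝ) ≤ n := by exact_mod_cast hn
    have hc : (0 : ℝ) ≤ (caretNumber n (ω : Circle ≃ₜ Circle) : ℝ) := by positivity
    nlinarith

end ThompsonPaper
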